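/- arXiv:math/0703902 — 2 statements merged into one kernel-verified Lean document; each statement's English description precedes it below -/
import Mathlib

section
/- Fix a constant ε > 0 and for each n let p = p(n) = (2+ε)·(log n)/n. Let Z_G denote the number of pure Nash equilibria of a random game on a graph G on n vertices. Then there exist constants C, c > 0 (depending only on ε) such that for all sufficiently large n, with probability at least 1 − 2·n^{−ε/8} over a graph G drawn from the Erdős–Rényi model G(n,p), the total variation distance between the law of Z_G and a Poisson(1) random variable W satisfies ||Z_G − W|| ≤ C·n^{−ε/8} + C·e^{−c·n}. -/
open scoped Classical
open Finset

/-- Best-response tables of a game with `n` binary-strategy players: player `v`'s table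
assigns a best response `ω v τ ∈ {0,1}` to each (masked) strategy profile `τ`.
Only the values at profiles vanishing outside the neighborhood of `v` are ever read,
so under the uniform measure the read entries are i.i.d. uniform on `{0,1}`. -/
abbrev Tables (n : ℕ) := Fin n → (Fin n → Bool) → Bool

/-- Potential edges of a graph on `Fin n`: ordered pairs `(u,v)` with `u < v`. -/
abbrev EdgePair (n : ℕ) := {q : Fin n × Fin n // q.1 < q.2}

/-- A sample of the Erdős–Rényi graph: an indicator of presence for each potential edge. -/
abbrev GraphSeed (n : ℕ) := EdgePair n → Bool

/-- Adjacency relation of the graph determined by a graph seed. -/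
def adjB {n : ℕ} (g : GraphSeed n) (u v : Fin n) : Bool :=
  if h : u < v then g ⟨(u, v), h⟩
  else if h' : v < u then g ⟨(v, u), h'⟩
  else false

/-- Restriction of a strategy profile to the neighborhood of `v`
(strategies outside the neighborhood are replaced by `false`). -/
def maskG {n : ℕ} (g : GraphSeed n) (v : Fin n) (σ : Fin n → Bool) : Fin n → Bool :=
  fun u => if adjB g v u then σ u else false

/-- `σ` is a pure Nash equilibrium of the game on graph `g` with tables `ω`:
every player plays a best response to its neighborhood. -/
def isPNE {n : ℕ} (g : GraphSeed n) (ω : Tables n) (σ : Fin n → Bool) : Prop :=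
  ∀ v, σ v = ω v (maskG g v σ)

/-- Erdős–Rényi weight of a graph seed: each potential edge is present independently
with probability `p`. -/
noncomputable def graphWeight {n : ℕ} (p : ℝ) (g : GraphSeed n) : ℝ :=
  ∏ e : EdgePair n, if g e then p else 1 - p

/-- Probability of a graph event under the Erdős–Rényi measure `G(n,p)`. -/
noncomputable def probG (n : ℕ) (p : ℝ) (A : GraphSeed n → Prop) : ℝ :=
  ∑ g : GraphSeed n, if A g then graphWeight p g else 0

/-- Probability of a table event under the uniform measure on best-response tables. -/
noncomputable def probT (n : ℕ) (A : Tables n → Prop) : ℝ :=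
  (∑ ω : Tables n, if A ω then (1 : ℝ) else 0) / (Fintype.card (Tables n) : ℝ)

/-- The number `Z` of pure Nash equilibria of the game `(g, ω)`. -/
noncomputable def numPNE {n : ℕ} (g : GraphSeed n) (ω : Tables n) : ℕ :=
  (univ.filter fun σ : Fin n → Bool => isPNE g ω σ).card

/-- Total variation distance between the law of the number of PNE of a random game
on the (fixed) graph `g` and a Poisson random variable with mean `1`. -/
noncomputable def tvDistPoisson (n : ℕ) (g : GraphSeed n) : ℝ :=
  (1 / 2) * ∑' k : ℕ, |probT n (fun ω => numPNE g ω = k) - Real.exp (-1) / (Nat.factorial k : ℝ)|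


lemma summ_aux (h : ℕ → ℝ) (a : ℝ) (hh : ∀ k, |h k| ≤ a) :
    Summable fun k : ℕ => h k / (Nat.factorial k : ℝ) := by
  have h1 : Summable fun k : ℕ => a * ((1:ℝ) ^ k / (Nat.factorial k : ℝ)) :=
    (Real.summable_pow_div_factorial 1).mul_left a
  refine Summable.of_norm_bounded h1 fun k => ?_
  rw [Real.norm_eq_abs, abs_div, one_pow, mul_one_div, Nat.abs_cast]
  exact div_le_div_of_nonneg_right (hh k) (by positivity)

lemma tsum_inv_fact : ∑' k : ℕ, (1:ℝ) / (Nat.factorial k : ℝ) = Real.exp 1 := by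
  rw [Real.exp_eq_exp_ℝ, NormedSpace.exp_eq_tsum_div]
  simp

noncomputable def steinF (c : ℕ → ℝ) : ℕ → ℝ
  | 0 => 0
  | k + 1 => (Nat.factorial k : ℝ) * ∑ j ∈ range (k + 1), c j / (Nat.factorial j : ℝ)

lemma steinF_rec (c : ℕ → ℝ) (k : ℕ) : steinF c (k + 1) - k * steinF c k = c k := by
  cases k with
  | zero => simp [steinF]
  | succ m =>
    simp only [steinF]
    rw [Finset.sum_range_succ _ (m + 1), mul_add, Nat.factorial_succ]
    have : (Nat.factorial m : ℝ) ≠ 0 := by positivity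
    push_cast
    field_simp
    ring

lemma steinF_bound (c : ℕ → ℝ) (hc : ∀ k, |c k| ≤ 2)
    (h0 : ∑' k : ℕ, c k / (Nat.factorial k : ℝ) = 0) (k : ℕ) : |steinF c k| ≤ 6 := by
  cases k with
  | zero => simp [steinF]
  | succ m =>
    simp only [steinF]
    have hs := summ_aux c 2 hc
    have h1 := hs.sum_add_tsum_nat_add (m + 1)
    rw [h0] at h1
    have h2 : ∑ j ∈ range (m + 1), c j / (Nat.factorial j : ℝ)
        = - ∑' i : ℕ, c (i + (m + 1)) / (Nat.factorial (i + (m + 1)) : ℝ) := by linarith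
    rw [h2, mul_neg, abs_neg, ← tsum_mul_left]
    have hs1 : Summable fun k : ℕ => 2 * ((1:ℝ) / (Nat.factorial k : ℝ)) :=
      (summ_aux (fun _ => 1) 1 (by simp)).mul_left 2
    have h3 : ‖∑' i : ℕ, (Nat.factorial m : ℝ) * (c (i + (m + 1)) / (Nat.factorial (i + (m + 1)) : ℝ))‖
        ≤ ∑' k : ℕ, 2 * ((1:ℝ) / (Nat.factorial k : ℝ)) := by
      refine tsum_of_norm_bounded hs1.hasSum fun i => ?_
      rw [Real.norm_eq_abs, abs_mul, abs_div, Nat.abs_cast, Nat.abs_cast]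
      have hf : (Nat.factorial m : ℝ) * Nat.factorial i ≤ Nat.factorial (i + (m + 1)) := by
        have a1 : Nat.factorial m * Nat.factorial i ≤ Nat.factorial (m + i) :=
          Nat.le_of_dvd (Nat.factorial_pos _) (Nat.factorial_mul_factorial_dvd_factorial_add m i)
        have a2 : Nat.factorial (m + i) ≤ Nat.factorial (i + (m + 1)) :=
          Nat.factorial_le (by omega)
        exact_mod_cast a1.trans a2
      have p1 : (0:ℝ) < Nat.factorial i := by positivity
      have p2 : (0:ℝ) < Nat.factorial (i + (m + 1)) := by positivity
      rw [mul_div_assoc', mul_one_div, div_le_div_iff₀ p2 p1]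
      have := hc (i + (m + 1))
      calc (Nat.factorial m : ℝ) * |c (i + (m + 1))| * Nat.factorial i
          = |c (i + (m + 1))| * ((Nat.factorial m : ℝ) * Nat.factorial i) := by ring
        _ ≤ _ := mul_le_mul this hf (by positivity) (by norm_num)
    rw [tsum_mul_left (a := (2:ℝ)), tsum_inv_fact, Real.norm_eq_abs] at h3
    have := Real.exp_one_lt_d9
    linarith

/-- Solution of the Stein equation. -/
lemma stein_exists (h : ℕ → ℝ) (hh : ∀ k, |h k| ≤ 1) :
    ∃ f : ℕ → ℝ, (∀ k, |f k| ≤ 6) ∧ ∀ k : ℕ, f (k + 1) - k * f k =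
      h k - ∑' j : ℕ, h j * (Real.exp (-1) / (Nat.factorial j : ℝ)) := by
  set μ := ∑' j : ℕ, h j * (Real.exp (-1) / (Nat.factorial j : ℝ)) with hμ
  have e1 : μ = Real.exp (-1) * ∑' j : ℕ, h j / (Nat.factorial j : ℝ) := by
    rw [hμ, ← tsum_mul_left]; congr 1; ext j; ring
  have hs := summ_aux h 1 hh
  have hs1 : Summable fun k : ℕ => ((1:ℝ) / (Nat.factorial k : ℝ)) :=
      (summ_aux (fun _ => 1) 1 (by simp))
  have hee : Real.exp (-1) * Real.exp 1 = 1 := by rw [← Real.exp_add]; simp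
  have hb : |∑' j : ℕ, h j / (Nat.factorial j : ℝ)| ≤ Real.exp 1 := by
    rw [← tsum_inv_fact]
    rw [← Real.norm_eq_abs]
    refine tsum_of_norm_bounded hs1.hasSum fun k => ?_
    rw [Real.norm_eq_abs, abs_div, Nat.abs_cast]
    exact div_le_div_of_nonneg_right (hh k) (by positivity)
  have hμ1 : |μ| ≤ 1 := by
    rw [e1, abs_mul, abs_of_pos (Real.exp_pos _)]
    exact (mul_le_mul_of_nonneg_left hb (Real.exp_pos _).le).trans hee.le
  refine ⟨steinF (fun k => h k - μ), steinF_bound _ (fun k => ?_) ?_, fun k => steinF_rec _ k⟩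
  · have := abs_sub (h k) μ
    have := hh k
    linarith
  · have : (fun k : ℕ => (h k - μ) / (Nat.factorial k : ℝ))
        = fun k : ℕ => h k / (Nat.factorial k : ℝ) - μ * (1 / (Nat.factorial k : ℝ)) := by
      ext k; ring
    rw [this, hs.tsum_sub (hs1.mul_left μ), tsum_mul_left, tsum_inv_fact, e1]
    linear_combination (-(∑' j : ℕ, h j / (Nat.factorial j : ℝ))) * hee

/-- TV bound through Stein functions. -/
lemma tv_stein (n : ℕ) (g : GraphSeed n) (b : ℝ)
    (H : ∀ f : ℕ → ℝ, (∀ k, |f k| ≤ 6) →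
      ∑ ω : Tables n, (f (numPNE g ω + 1) - (numPNE g ω : ℝ) * f (numPNE g ω))
        ≤ b * (Fintype.card (Tables n) : ℝ)) :
    tvDistPoisson n g ≤ b / 2 := by
  set P : ℕ → ℝ := fun k => probT n (fun ω => numPNE g ω = k) with hP
  set q : ℕ → ℝ := fun k => Real.exp (-1) / (Nat.factorial k : ℝ) with hq
  set h : ℕ → ℝ := fun k => if 0 ≤ P k - q k then 1 else -1 with hh
  have hh1 : ∀ k, |h k| ≤ 1 := by
    intro k; simp only [hh]; split_ifs <;> simp
  obtain ⟨f, hf, hfe⟩ := stein_exists h hh1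
  have hcard : (0:ℝ) < (Fintype.card (Tables n) : ℝ) := by
    exact_mod_cast Fintype.card_pos
  have habs : ∀ k, |P k - q k| = h k * P k - h k * q k := by
    intro k
    simp only [hh]
    split_ifs with h0
    · rw [abs_of_nonneg h0]; ring
    · rw [abs_of_neg (not_le.mp h0)]; ring
  have hsup : ∀ k ∉ (univ : Finset (Tables n)).image (numPNE g), h k * P k = 0 := by
    intro k hk
    have : P k = 0 := by
      simp only [hP, probT]
      rw [Finset.sum_eq_zero, zero_div]
      intro ω _
      rw [if_neg]
      intro e
      exact hk (Finset.mem_image.mpr ⟨ω, mem_univ _, e⟩)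
    rw [this, mul_zero]
  have hs1 : Summable fun k => h k * P k := summable_of_ne_finset_zero hsup
  have hs2 : Summable fun k => h k * q k := by
    have := (summ_aux h 1 hh1).mul_left (Real.exp (-1))
    refine this.congr fun k => ?_
    simp only [hq]; ring
  have hE : ∑' k, h k * P k = (∑ ω : Tables n, h (numPNE g ω)) / (Fintype.card (Tables n) : ℝ) := by
    rw [tsum_eq_sum hsup]
    simp only [hP, probT]
    simp_rw [mul_div_assoc']
    rw [← Finset.sum_div]
    congr 1
    simp_rw [Finset.mul_sum]
    rw [Finset.sum_comm]
    refine Finset.sum_congr rfl fun ω _ => ?_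
    rw [Finset.sum_eq_single (numPNE g ω)]
    · simp
    · intro k _ hk
      rw [if_neg (Ne.symm hk), mul_zero]
    · intro hk
      exact absurd (Finset.mem_image.mpr ⟨ω, mem_univ _, rfl⟩) hk
  have key := H f hf
  simp_rw [hfe] at key
  rw [Finset.sum_sub_distrib, Finset.sum_const, nsmul_eq_mul, Finset.card_univ] at key
  have : tvDistPoisson n g = (1 / 2) * ∑' k, |P k - q k| := rfl
  rw [this]
  simp_rw [habs]
  rw [hs1.tsum_sub hs2, hE]
  have : (∑ ω : Tables n, h (numPNE g ω)) / (Fintype.card (Tables n) : ℝ)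
      ≤ b + ∑' k, h k * q k := by
    rw [div_le_iff₀ hcard]
    nlinarith [key]
  linarith

def flipT {n : ℕ} (v : Fin n) (t : Fin n → Bool) (ω : Tables n) : Tables n :=
  Function.update ω v (Function.update (ω v) t (!(ω v t)))

lemma flipT_self {n : ℕ} (v : Fin n) (t : Fin n → Bool) (ω : Tables n) :
    flipT v t ω v t = !(ω v t) := by simp [flipT]

lemma flipT_ne {n : ℕ} (v : Fin n) (t : Fin n → Bool) (ω : Tables n) (w : Fin n)
    (s : Fin n → Bool) (h : w ≠ v ∨ s ≠ t) : flipT v t ω w s = ω w s := by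
  by_cases hw : w = v
  · subst hw
    have : s ≠ t := by tauto
    simp [flipT, this]
  · simp [flipT, hw]

lemma flipT_inv {n : ℕ} (v : Fin n) (t : Fin n → Bool) :
    Function.Involutive (flipT v t) := by
  intro ω
  funext w s
  by_cases h : w = v ∧ s = t
  · obtain ⟨rfl, rfl⟩ := h
    rw [flipT_self, flipT_self, Bool.not_not]
  · have h' : w ≠ v ∨ s ≠ t := by tauto
    rw [flipT_ne _ _ _ _ _ h', flipT_ne _ _ _ _ _ h']

lemma indep_one {n : ℕ} (v : Fin n) (t : Fin n → Bool) (a : Bool) (F : Tables n → ℝ)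
    (hF : ∀ ω, F (flipT v t ω) = F ω) :
    (∑ ω : Tables n, if a = ω v t then F ω else 0) * 2 = ∑ ω : Tables n, F ω := by
  have h1 : (∑ ω : Tables n, if a = ω v t then F ω else 0)
      = ∑ ω : Tables n, if a = flipT v t ω v t then F (flipT v t ω) else 0 :=
    ((flipT_inv v t).bijective.sum_comp (fun ω => if a = ω v t then F ω else 0)).symm
  rw [mul_two]
  nth_rewrite 2 [h1]
  rw [← Finset.sum_add_distrib]
  refine Finset.sum_congr rfl fun ω _ => ?_
  rw [flipT_self, hF]
  cases a <;> cases ω v t <;> simp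

lemma indep_many {n : ℕ} (m : Fin n → (Fin n → Bool)) (a : Fin n → Bool) (F : Tables n → ℝ)
    (D : Finset (Fin n)) (hF : ∀ ω, ∀ v ∈ D, F (flipT v (m v) ω) = F ω) :
    (∑ ω : Tables n, if ∀ v ∈ D, a v = ω v (m v) then F ω else 0) * 2 ^ D.card
      = ∑ ω : Tables n, F ω := by
  induction D using Finset.induction_on with
  | empty => simp
  | insert v D hv ih =>
    rw [← ih (fun ω w hw => hF ω w (Finset.mem_insert_of_mem hw)), Finset.card_insert_of_notMem hv,
      pow_succ']
    rw [← indep_one v (m v) (a v) (fun ω => if ∀ v ∈ D, a v = ω v (m v) then F ω else 0)]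
    · have : ∀ ω : Tables n, (if ∀ w ∈ insert v D, a w = ω w (m w) then F ω else 0)
          = if a v = ω v (m v) then (if ∀ v ∈ D, a v = ω v (m v) then F ω else 0) else 0 := by
        intro ω
        rw [← ite_and]
        simp only [Finset.forall_mem_insert]
      simp_rw [this]
      ring
    · intro ω
      rw [hF ω v (Finset.mem_insert_self _ _)]
      congr 1
      apply propext
      refine forall₂_congr fun w hw => ?_
      rw [flipT_ne]
      left
      rintro rfl
      exact hv hw

noncomputable def XX {n : ℕ} (g : GraphSeed n) (σ : Fin n → Bool) (ω : Tables n) : ℝ :=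
  if isPNE g ω σ then 1 else 0

def near {n : ℕ} (g : GraphSeed n) (σ τ : Fin n → Bool) : Prop :=
  ∃ v, maskG g v σ = maskG g v τ

noncomputable def Zs {n : ℕ} (g : GraphSeed n) (σ : Fin n → Bool) (ω : Tables n) : ℕ :=
  (univ.filter fun τ : Fin n → Bool => isPNE g ω τ ∧ ¬ near g σ τ).card

lemma XX_nonneg {n : ℕ} (g : GraphSeed n) (σ : Fin n → Bool) (ω : Tables n) : 0 ≤ XX g σ ω := by
  unfold XX; split_ifs <;> norm_num

lemma XX_indep {n : ℕ} (g : GraphSeed n) (σ : Fin n → Bool) (F : Tables n → ℝ)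
    (hF : ∀ ω v, F (flipT v (maskG g v σ) ω) = F ω) :
    (∑ ω : Tables n, XX g σ ω * F ω) * 2 ^ n = ∑ ω : Tables n, F ω := by
  rw [← indep_many (fun v => maskG g v σ) σ F univ (fun ω v _ => hF ω v)]
  simp only [XX, Finset.mem_univ, true_imp_iff, Finset.card_univ, Fintype.card_fin]
  congr 1
  refine Finset.sum_congr rfl fun ω _ => ?_
  by_cases h : isPNE g ω σ
  · have h' : ∀ v, σ v = ω v (maskG g v σ) := h
    rw [if_pos h, if_pos h', one_mul]
  · have h' : ¬ ∀ v, σ v = ω v (maskG g v σ) := h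
    rw [if_neg h, if_neg h', zero_mul]

lemma XX_mean {n : ℕ} (g : GraphSeed n) (σ : Fin n → Bool) :
    (∑ ω : Tables n, XX g σ ω) * 2 ^ n = (Fintype.card (Tables n) : ℝ) := by
  have := XX_indep g σ (fun _ => 1) (by simp)
  simpa using this

lemma Zs_flip {n : ℕ} (g : GraphSeed n) (σ : Fin n → Bool) (ω : Tables n) (v : Fin n) :
    Zs g σ (flipT v (maskG g v σ) ω) = Zs g σ ω := by
  unfold Zs
  congr 1
  refine Finset.filter_congr fun τ _ => ?_
  refine and_congr_left fun hn => ?_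
  refine forall_congr' fun w => ?_
  rw [flipT_ne]
  by_cases hw : w = v
  · right
    subst hw
    exact fun e => hn ⟨w, e.symm⟩
  · left; exact hw

lemma numPNE_eq {n : ℕ} (g : GraphSeed n) (ω : Tables n) :
    (numPNE g ω : ℝ) = ∑ σ : Fin n → Bool, XX g σ ω := by
  simp [numPNE, XX]

lemma numPNE_sub {n : ℕ} (g : GraphSeed n) (σ : Fin n → Bool) (ω : Tables n) :
    (numPNE g ω : ℝ) = Zs g σ ω + ∑ τ : Fin n → Bool, if near g σ τ then XX g τ ω else 0 := by
  have h : (Zs g σ ω : ℝ) = ∑ τ : Fin n → Bool, if near g σ τ then 0 else XX g τ ω := by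
    simp only [Zs, XX, Finset.card_filter]
    push_cast
    refine Finset.sum_congr rfl fun τ _ => ?_
    by_cases h1 : near g σ τ <;> simp [h1]
  rw [numPNE_eq, h, ← Finset.sum_add_distrib]
  refine Finset.sum_congr rfl fun τ _ => ?_
  split_ifs <;> simp

lemma lip_aux (f : ℕ → ℝ) (hf : ∀ k, |f k| ≤ 6) (a b : ℕ) (h : (b:ℝ) ≤ a) :
    |f a - f b| ≤ 12 * ((a:ℝ) - b) := by
  have h' : b ≤ a := by exact_mod_cast h
  rcases h'.eq_or_lt with e | e
  · subst e; simp
  · have : (b:ℝ) + 1 ≤ a := by exact_mod_cast e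
    have := abs_sub (f a) (f b)
    have := hf a
    have := hf b
    linarith

/-- Chen-Stein. -/
lemma chen_stein {n : ℕ} (hn : 0 < n) (g : GraphSeed n) (f : ℕ → ℝ) (hf : ∀ k, |f k| ≤ 6)
    (A B : ℝ)
    (hA : ∀ σ : Fin n → Bool, (∑ τ : Fin n → Bool, if near g σ τ then (1:ℝ) else 0) ≤ A)
    (hB : ∀ σ : Fin n → Bool, (∑ τ : Fin n → Bool, if near g σ τ ∧ τ ≠ σ then
        (∑ ω : Tables n, XX g σ ω * XX g τ ω) else 0) * 2 ^ n * 2 ^ n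
          ≤ B * (Fintype.card (Tables n) : ℝ)) :
    ∑ ω : Tables n, (f (numPNE g ω + 1) - (numPNE g ω : ℝ) * f (numPNE g ω))
        ≤ (12 * (A + B) / 2 ^ n) * (Fintype.card (Tables n) : ℝ) := by
  set c := (Fintype.card (Tables n) : ℝ) with hc
  have hp : (0:ℝ) < 2 ^ n := by positivity
  -- per sigma bound
  have key : ∀ σ : Fin n → Bool,
      (∑ ω : Tables n, f (numPNE g ω + 1)) - (∑ ω : Tables n, XX g σ ω * f (numPNE g ω)) * 2 ^ n
        ≤ 12 * (A + B) / 2 ^ n * c := by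
    intro σ
    have i1 := XX_indep g σ (fun ω => f (Zs g σ ω + 1)) (fun ω v => by rw [Zs_flip])
    have h1 : ∑ ω : Tables n, f (numPNE g ω + 1) - ∑ ω : Tables n, f (Zs g σ ω + 1)
        ≤ 12 * A / 2 ^ n * c := by
      rw [← Finset.sum_sub_distrib]
      have : ∀ ω : Tables n, f (numPNE g ω + 1) - f (Zs g σ ω + 1)
          ≤ 12 * ∑ τ : Fin n → Bool, if near g σ τ then XX g τ ω else 0 := by
        intro ω
        have e := numPNE_sub g σ ω
        have nn : 0 ≤ ∑ τ : Fin n → Bool, if near g σ τ then XX g τ ω else 0 :=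
          Finset.sum_nonneg fun τ _ => by split_ifs; exacts [XX_nonneg _ _ _, le_rfl]
        have := lip_aux f hf (numPNE g ω + 1) (Zs g σ ω + 1) (by push_cast; linarith)
        push_cast at this
        have := (le_abs_self _).trans this
        linarith
      refine (Finset.sum_le_sum fun ω _ => this ω).trans ?_
      rw [← Finset.mul_sum, Finset.sum_comm]
      have e2 : ∀ τ : Fin n → Bool, (∑ ω : Tables n, if near g σ τ then XX g τ ω else 0)
          = (if near g σ τ then (1:ℝ) else 0) * (c / 2 ^ n) := by
        intro τ
        split_ifs
        · rw [one_mul, eq_div_iff hp.ne', XX_mean]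
        · simp
      simp_rw [e2]
      rw [← Finset.sum_mul]
      have hc0 : 0 ≤ c / 2 ^ n := by positivity
      have := mul_le_mul_of_nonneg_right (hA σ) hc0
      calc _ ≤ 12 * (A * (c / 2 ^ n)) := by linarith
        _ = _ := by ring
    have h2 : (∑ ω : Tables n, XX g σ ω * f (Zs g σ ω + 1))
        - (∑ ω : Tables n, XX g σ ω * f (numPNE g ω))
        ≤ 12 * (∑ τ : Fin n → Bool, if near g σ τ ∧ τ ≠ σ then
        (∑ ω : Tables n, XX g σ ω * XX g τ ω) else 0) := by
      rw [← Finset.sum_sub_distrib]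
      have : ∀ ω : Tables n, XX g σ ω * f (Zs g σ ω + 1) - XX g σ ω * f (numPNE g ω)
          ≤ 12 * ∑ τ : Fin n → Bool, if near g σ τ ∧ τ ≠ σ then XX g σ ω * XX g τ ω else 0 := by
        intro ω
        by_cases hX : isPNE g ω σ
        · have hX1 : XX g σ ω = 1 := by simp [XX, hX]
          rw [hX1]
          simp only [one_mul]
          have e := numPNE_sub g σ ω
          have hnear : near g σ σ := ⟨⟨0, hn⟩, rfl⟩
          have e3 : (∑ τ : Fin n → Bool, if near g σ τ then XX g τ ω else 0)
              = 1 + ∑ τ : Fin n → Bool, if near g σ τ ∧ τ ≠ σ then XX g τ ω else 0 := by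
            have : (1:ℝ) = ∑ τ : Fin n → Bool, if τ = σ then XX g τ ω else 0 := by
              simp [hX1]
            rw [this, ← Finset.sum_add_distrib]
            refine Finset.sum_congr rfl fun τ _ => ?_
            by_cases h : τ = σ
            · subst h; simp [hnear]
            · simp [h]
          have nn : 0 ≤ ∑ τ : Fin n → Bool, if near g σ τ ∧ τ ≠ σ then XX g τ ω else 0 :=
            Finset.sum_nonneg fun τ _ => by split_ifs; exacts [XX_nonneg _ _ _, le_rfl]
          have := lip_aux f hf (numPNE g ω) (Zs g σ ω + 1) (by push_cast; linarith)
          push_cast at this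
          rw [abs_sub_comm] at this
          have := (le_abs_self _).trans this
          linarith
        · have hX1 : XX g σ ω = 0 := by simp [XX, hX]
          simp [hX1]
      refine (Finset.sum_le_sum fun ω _ => this ω).trans ?_
      rw [← Finset.mul_sum, Finset.sum_comm]
      refine le_of_eq ?_
      congr 1
      refine Finset.sum_congr rfl fun τ _ => ?_
      split_ifs <;> simp
    have h3 := hB σ
    set Q := ∑ τ : Fin n → Bool, if near g σ τ ∧ τ ≠ σ then
        (∑ ω : Tables n, XX g σ ω * XX g τ ω) else 0
    have h4 : Q * 2 ^ n ≤ B * c / 2 ^ n := by rw [le_div_iff₀ hp]; exact h3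
    have h5 := mul_le_mul_of_nonneg_right h2 hp.le
    rw [sub_mul, i1] at h5
    have : 12 * (A + B) / 2 ^ n * c = 12 * A / 2 ^ n * c + 12 * (B * c / 2 ^ n) := by ring
    rw [this]
    linarith
  rw [Finset.sum_sub_distrib]
  have e4 : ∑ ω : Tables n, (numPNE g ω : ℝ) * f (numPNE g ω)
      = ∑ σ : Fin n → Bool, ∑ ω : Tables n, XX g σ ω * f (numPNE g ω) := by
    rw [Finset.sum_comm]
    refine Finset.sum_congr rfl fun ω _ => ?_
    rw [numPNE_eq, Finset.sum_mul]
  have hsum := Finset.sum_le_sum fun (σ : Fin n → Bool) (_ : σ ∈ univ) => key σ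
  rw [Finset.sum_sub_distrib, ← Finset.sum_mul, ← e4] at hsum
  simp only [Finset.sum_const, Finset.card_univ, nsmul_eq_mul] at hsum
  have hcb : ((Fintype.card (Fin n → Bool) : ℕ) : ℝ) = 2 ^ n := by simp
  rw [hcb] at hsum
  have : (∑ ω : Tables n, f (numPNE g ω + 1) - ∑ ω : Tables n, (numPNE g ω : ℝ) * f (numPNE g ω)) * 2 ^ n
     ≤ 12 * (A + B) / 2 ^ n * c * 2 ^ n := by linarith
  exact le_of_mul_le_mul_right this hp

lemma adjB_symm {n : ℕ} (g : GraphSeed n) (u v : Fin n) : adjB g u v = adjB g v u := by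
  unfold adjB
  rcases lt_trichotomy u v with h | h | h
  · simp [h, h.not_gt]
  · subst h; simp
  · simp [h, h.not_gt]

lemma adjB_self {n : ℕ} (g : GraphSeed n) (u : Fin n) : adjB g u u = false := by
  simp [adjB]

/-- vertices outside `S` without neighbours in `S` -/
noncomputable def iso {n : ℕ} (g : GraphSeed n) (S : Finset (Fin n)) : Finset (Fin n) :=
  univ.filter fun v => v ∉ S ∧ ∀ u ∈ S, adjB g v u = false

noncomputable def MM {n : ℕ} (g : GraphSeed n) : ℝ :=
  ∑ S : Finset (Fin n), if S.Nonempty then (2:ℝ) ^ (iso g S).card - 1 else 0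

noncomputable def dif {n : ℕ} (σ τ : Fin n → Bool) : Finset (Fin n) :=
  univ.filter fun u => σ u ≠ τ u

lemma dif_bij {n : ℕ} (σ : Fin n → Bool) : Function.Bijective (dif σ) := by
  rw [Fintype.bijective_iff_injective_and_card]
  refine ⟨fun τ τ' h => ?_, by simp⟩
  funext u
  have := Finset.ext_iff.mp h u
  simp only [dif, Finset.mem_filter, Finset.mem_univ, true_and] at this
  revert this
  cases σ u <;> cases τ u <;> cases τ' u <;> simp

lemma mask_iff {n : ℕ} (g : GraphSeed n) (σ τ : Fin n → Bool) (v : Fin n) :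
    maskG g v σ = maskG g v τ ↔ ∀ u ∈ dif σ τ, adjB g v u = false := by
  simp only [maskG, funext_iff, dif, Finset.mem_filter, Finset.mem_univ, true_and]
  refine forall_congr' fun u => ?_
  cases adjB g v u <;> simp

lemma near_iff {n : ℕ} (g : GraphSeed n) (σ τ : Fin n → Bool) :
    near g σ τ ↔ ∃ v, ∀ u ∈ dif σ τ, adjB g v u = false := by
  simp only [near, mask_iff]

lemma count_near {n : ℕ} (g : GraphSeed n) (σ : Fin n → Bool) :
    (∑ τ : Fin n → Bool, if near g σ τ then (1:ℝ) else 0) ≤ 2 * n + 2 * MM g := by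
  simp_rw [near_iff]
  rw [(dif_bij σ).sum_comp (fun S => if ∃ v, ∀ u ∈ S, adjB g v u = false then (1:ℝ) else 0)]
  have h1 : ∀ S : Finset (Fin n), (if ∃ v, ∀ u ∈ S, adjB g v u = false then (1:ℝ) else 0)
      ≤ ∑ v, if ∀ u ∈ S, adjB g v u = false then (1:ℝ) else 0 := by
    intro S
    split_ifs with h
    · obtain ⟨v, hv⟩ := h
      have := Finset.single_le_sum (f := fun v => if ∀ u ∈ S, adjB g v u = false then (1:ℝ) else 0)
        (fun i _ => by split_ifs <;> norm_num) (mem_univ v)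
      simp only [if_pos hv] at this
      exact this
    · exact Finset.sum_nonneg fun i _ => by split_ifs <;> norm_num
  refine (Finset.sum_le_sum fun S _ => h1 S).trans ?_
  rw [Finset.sum_comm]
  have h2 : ∀ v : Fin n, (∑ S : Finset (Fin n), if ∀ u ∈ S, adjB g v u = false then (1:ℝ) else 0)
      = 2 + 2 * ((2:ℝ) ^ (iso g {v}).card - 1) := by
    intro v
    have e1 : (univ.filter fun S : Finset (Fin n) => ∀ u ∈ S, adjB g v u = false)
        = (insert v (iso g {v})).powerset := by
      ext S
      simp only [Finset.mem_filter, Finset.mem_univ, true_and, Finset.mem_powerset, Finset.subset_iff]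
      refine forall₂_congr fun u _ => ?_
      simp only [Finset.mem_insert, iso, Finset.mem_filter, Finset.mem_univ, true_and,
        Finset.mem_singleton, forall_eq]
      rw [adjB_symm g u v]
      by_cases h : u = v
      · subst h; simp [adjB_self]
      · simp [h]
    rw [Finset.sum_boole, e1, Finset.card_powerset, Finset.card_insert_of_notMem (by simp [iso])]
    push_cast
    ring
  simp_rw [h2]
  rw [Finset.sum_add_distrib, ← Finset.mul_sum]
  simp only [Finset.sum_const, Finset.card_univ, Fintype.card_fin, nsmul_eq_mul]
  have h3 : ∑ v : Fin n, ((2:ℝ) ^ (iso g {v}).card - 1) ≤ MM g := by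
    have e2 : ∑ v : Fin n, ((2:ℝ) ^ (iso g {v}).card - 1)
        = ∑ S ∈ univ.image (fun v : Fin n => ({v} : Finset (Fin n))),
          if S.Nonempty then (2:ℝ) ^ (iso g S).card - 1 else 0 := by
      rw [Finset.sum_image (fun a _ b _ h => Finset.singleton_injective h)]
      simp
    rw [e2]
    refine Finset.sum_le_sum_of_subset_of_nonneg (Finset.subset_univ _) fun S _ _ => ?_
    split_ifs
    · have : (1:ℝ) ≤ 2 ^ (iso g S).card := one_le_pow₀ (by norm_num)
      linarith
    · rfl
  linarith

lemma pair_bound {n : ℕ} (g : GraphSeed n) (σ τ : Fin n → Bool) :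
    (if near g σ τ ∧ τ ≠ σ then (∑ ω : Tables n, XX g σ ω * XX g τ ω) else 0) * 2 ^ n * 2 ^ n
      ≤ (if (dif σ τ).Nonempty then 2 * ((2:ℝ) ^ (iso g (dif σ τ)).card - 1) else 0)
        * (Fintype.card (Tables n) : ℝ) := by
  set c := (Fintype.card (Tables n) : ℝ) with hc
  have hc0 : 0 ≤ c := by positivity
  have hpw : (1:ℝ) ≤ 2 ^ (iso g (dif σ τ)).card := one_le_pow₀ (by norm_num)
  have hr : 0 ≤ (if (dif σ τ).Nonempty then 2 * ((2:ℝ) ^ (iso g (dif σ τ)).card - 1) else 0) * c := by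
    refine mul_nonneg ?_ hc0
    split_ifs
    · linarith
    · rfl
  split_ifs with h1 h2 h2
  · by_cases h3 : ∃ v ∈ dif σ τ, ∀ u ∈ dif σ τ, adjB g v u = false
    · obtain ⟨v, hv, hv2⟩ := h3
      have : ∑ ω : Tables n, XX g σ ω * XX g τ ω = 0 := by
        refine Finset.sum_eq_zero fun ω _ => ?_
        unfold XX
        by_cases ha : isPNE g ω σ
        · by_cases hb : isPNE g ω τ
          · exfalso
            have e := (mask_iff g σ τ v).mpr hv2
            have a1 := ha v
            have b1 := hb v
            rw [← e, ← a1] at b1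
            simp only [dif, Finset.mem_filter] at hv
            exact hv.2 b1.symm
          · simp [hb]
        · simp [ha]
      rw [this]
      rw [if_pos h2] at hr
      rw [zero_mul, zero_mul]
      exact hr
    · -- K ≥ 1
      have hK : ∀ v, maskG g v σ = maskG g v τ ↔ v ∈ iso g (dif σ τ) := by
        intro v
        rw [mask_iff]
        simp only [iso, Finset.mem_filter, Finset.mem_univ, true_and]
        constructor
        · exact fun h => ⟨fun hv => h3 ⟨v, hv, h⟩, h⟩
        · exact fun h => h.2
      have hne : 1 ≤ (iso g (dif σ τ)).card := by
        obtain ⟨v, hv⟩ := h1.1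
        exact Finset.card_pos.mpr ⟨v, (hK v).mp hv⟩
      set K := (iso g (dif σ τ)).card with hKd
      set D := (iso g (dif σ τ))ᶜ with hD
      have hDK : D.card + K = n := by
        rw [hD, hKd]
        have := Finset.card_compl_add_card (iso g (dif σ τ))
        simpa using this
      set F : Tables n → ℝ := fun ω => if ∀ v ∈ D, τ v = ω v (maskG g v τ) then 1 else 0 with hF
      have i1 := indep_many (fun v => maskG g v τ) τ (fun _ => (1:ℝ)) D (by simp)
      have i2 := XX_indep g σ F (by
        intro ω v
        simp only [hF]
        congr 1
        apply propext
        refine forall₂_congr fun w hw => ?_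
        rw [flipT_ne]
        by_cases hwv : w = v
        · right
          subst hwv
          intro e
          rw [hD, Finset.mem_compl] at hw
          exact hw ((hK w).mp e.symm)
        · left; exact hwv)
      have i3 : ∑ ω : Tables n, XX g σ ω * XX g τ ω ≤ ∑ ω : Tables n, XX g σ ω * F ω := by
        refine Finset.sum_le_sum fun ω _ => mul_le_mul_of_nonneg_left ?_ (XX_nonneg _ _ _)
        simp only [XX, hF]
        split_ifs with ha hb
        · rfl
        · exact absurd (fun v _ => ha v) hb
        · norm_num
        · norm_num
      have i1' : (∑ ω : Tables n, F ω) * 2 ^ D.card = c := by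
        rw [hF, i1]; simp [hc]
      have p2 : (0:ℝ) < 2 ^ n := by positivity
      have p3 : (2:ℝ) ^ n = 2 ^ D.card * 2 ^ K := by rw [← pow_add, hDK]
      calc (∑ ω : Tables n, XX g σ ω * XX g τ ω) * 2 ^ n * 2 ^ n
          ≤ (∑ ω : Tables n, XX g σ ω * F ω) * 2 ^ n * 2 ^ n := by gcongr
        _ = (∑ ω : Tables n, F ω) * 2 ^ n := by rw [i2]
        _ = c * 2 ^ K := by rw [p3, ← mul_assoc, i1']
        _ ≤ 2 * (2 ^ K - 1) * c := by
          have : (2:ℝ) ≤ 2 ^ K := by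
            calc (2:ℝ) = 2 ^ 1 := by norm_num
              _ ≤ 2 ^ K := pow_le_pow_right₀ (by norm_num) hne
          nlinarith
  · exfalso
    apply h1.2
    funext u
    by_contra hu
    exact h2 ⟨u, by simp only [dif, Finset.mem_filter, Finset.mem_univ, true_and]; exact fun e => hu e.symm⟩
  · rw [if_pos h2] at hr
    simpa using hr
  · simp

lemma tv_bound {n : ℕ} (hn : 0 < n) (g : GraphSeed n) :
    tvDistPoisson n g ≤ 12 * n / 2 ^ n + 24 * (MM g / 2 ^ n) := by
  have := tv_stein n g (12 * ((2 * n + 2 * MM g) + 2 * MM g) / 2 ^ n) fun f hf => by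
    refine chen_stein hn g f hf _ _ (count_near g) fun σ => ?_
    rw [Finset.sum_mul, Finset.sum_mul]
    refine (Finset.sum_le_sum fun τ _ => pair_bound g σ τ).trans ?_
    rw [← Finset.sum_mul]
    refine le_of_eq ?_
    congr 1
    rw [(dif_bij σ).sum_comp (fun S => if S.Nonempty then 2 * ((2:ℝ) ^ (iso g S).card - 1) else 0),
      MM, Finset.mul_sum]
    refine Finset.sum_congr rfl fun S _ => ?_
    split_ifs <;> simp
  refine this.trans (le_of_eq ?_)
  ring

lemma sum_prod_bool {n : ℕ} (φ : EdgePair n → Bool → ℝ) :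
    ∑ g : GraphSeed n, ∏ e, φ e (g e) = ∏ e, (φ e true + φ e false) := by
  have := Finset.prod_univ_sum (fun _ : EdgePair n => (univ : Finset Bool)) φ
  rw [Fintype.piFinset_univ] at this
  rw [← this]
  simp

lemma graphWeight_sum {n : ℕ} (p : ℝ) : ∑ g : GraphSeed n, graphWeight p g = 1 := by
  unfold graphWeight
  rw [sum_prod_bool (fun _ b => if b then p else 1 - p)]
  simp

lemma graphWeight_nonneg {n : ℕ} (p : ℝ) (h0 : 0 ≤ p) (h1 : p ≤ 1) (g : GraphSeed n) :
    0 ≤ graphWeight p g := by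
  refine Finset.prod_nonneg fun e _ => ?_
  split_ifs <;> linarith

lemma noedge {n : ℕ} (p : ℝ) (h0 : 0 ≤ p) (h1 : p ≤ 1) (S T : Finset (Fin n)) :
    (∑ g : GraphSeed n, if T ⊆ iso g S then graphWeight p g else 0)
      ≤ (1 - p) ^ (S.card * T.card) := by
  by_cases hd : Disjoint S T
  swap
  · rw [Finset.sum_eq_zero]
    · exact pow_nonneg (by linarith) _
    · intro g _
      rw [if_neg]
      intro h
      apply hd
      rw [Finset.disjoint_right]
      intro v hv
      have := h hv
      simp only [iso, Finset.mem_filter] at this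
      exact this.2.1
  set E : Finset (EdgePair n) := univ.filter fun e =>
    (e.1.1 ∈ S ∧ e.1.2 ∈ T) ∨ (e.1.1 ∈ T ∧ e.1.2 ∈ S) with hE
  have hcard : S.card * T.card ≤ E.card := by
    rw [← Finset.card_product]
    refine Finset.card_le_card_of_surjOn
      (fun e : EdgePair n => if e.1.1 ∈ S then (e.1.1, e.1.2) else (e.1.2, e.1.1)) ?_
    rintro ⟨u, v⟩ huv
    rw [Finset.mem_coe, Finset.mem_product] at huv
    obtain ⟨hu, hv⟩ := huv
    have hvS : v ∉ S := Finset.disjoint_right.mp hd hv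
    simp only at hu hv
    rcases lt_trichotomy u v with h | h | h
    · refine ⟨⟨(u, v), h⟩, ?_, ?_⟩
      · simp [hE, hu, hv]
      · simp [hu]
    · subst h; exact absurd hu hvS
    · refine ⟨⟨(v, u), h⟩, ?_, ?_⟩
      · simp [hE, hu, hv]
      · simp [hvS]
  set φ : EdgePair n → Bool → ℝ := fun e b =>
    if e ∈ E ∧ b = true then 0 else (if b then p else 1 - p) with hφ
  have hle : ∀ g : GraphSeed n, (if T ⊆ iso g S then graphWeight p g else 0) ≤ ∏ e, φ e (g e) := by
    intro g
    split_ifs with h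
    · refine le_of_eq (Finset.prod_congr rfl fun e _ => ?_)
      simp only [hφ]
      refine (if_neg ?_).symm
      rintro ⟨he, hg⟩
      simp only [hE, Finset.mem_filter, Finset.mem_univ, true_and] at he
      have hadj : adjB g e.1.1 e.1.2 = true := by
        simp only [adjB, dif_pos e.2]
        exact hg
      rcases he with ⟨ha, hb⟩ | ⟨ha, hb⟩
      · have := h hb
        simp only [iso, Finset.mem_filter] at this
        have := this.2.2 _ ha
        rw [adjB_symm, hadj] at this
        exact absurd this (by simp)
      · have := h ha
        simp only [iso, Finset.mem_filter] at this
        have := this.2.2 _ hb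
        rw [hadj] at this
        exact absurd this (by simp)
    · refine Finset.prod_nonneg fun e _ => ?_
      simp only [hφ]
      split_ifs <;> linarith
  refine (Finset.sum_le_sum fun g _ => hle g).trans ?_
  rw [sum_prod_bool]
  have : ∀ e, φ e true + φ e false = if e ∈ E then 1 - p else 1 := by
    intro e
    simp only [hφ]
    by_cases he : e ∈ E <;> simp [he]
  simp_rw [this]
  rw [Finset.prod_ite_mem, Finset.univ_inter, Finset.prod_const]
  exact pow_le_pow_of_le_one (by linarith) (by linarith) hcard

lemma MM_eq {n : ℕ} (g : GraphSeed n) : MM g = ∑ S : Finset (Fin n), ∑ T : Finset (Fin n),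
    if S.Nonempty ∧ T.Nonempty then (if T ⊆ iso g S then (1:ℝ) else 0) else 0 := by
  unfold MM
  refine Finset.sum_congr rfl fun S _ => ?_
  by_cases hS : S.Nonempty
  · simp only [hS, if_true, true_and]
    have e : ∀ T : Finset (Fin n), (if T.Nonempty then (if T ⊆ iso g S then (1:ℝ) else 0) else 0)
        = (if T ⊆ iso g S then (1:ℝ) else 0) - if T = ∅ then 1 else 0 := by
      intro T
      rcases T.eq_empty_or_nonempty with h | h
      · subst h; simp
      · simp [h, h.ne_empty]
    simp_rw [e]
    rw [Finset.sum_sub_distrib, Finset.sum_boole]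
    have : (univ.filter fun T : Finset (Fin n) => T ⊆ iso g S) = (iso g S).powerset := by
      ext; simp
    rw [this, Finset.card_powerset]
    simp
  · simp [hS]

lemma MM_nonneg {n : ℕ} (g : GraphSeed n) : 0 ≤ MM g := by
  rw [MM_eq]
  refine Finset.sum_nonneg fun S _ => Finset.sum_nonneg fun T _ => ?_
  split_ifs <;> norm_num

lemma MM_mean {n : ℕ} (p : ℝ) (h0 : 0 ≤ p) (h1 : p ≤ 1) :
    ∑ g : GraphSeed n, graphWeight p g * MM g ≤
      ∑ S : Finset (Fin n), ∑ T : Finset (Fin n),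
        if S.Nonempty ∧ T.Nonempty then (1 - p) ^ (S.card * T.card) else 0 := by
  simp_rw [MM_eq, Finset.mul_sum]
  rw [Finset.sum_comm]
  refine Finset.sum_le_sum fun S _ => ?_
  rw [Finset.sum_comm]
  refine Finset.sum_le_sum fun T _ => ?_
  split_ifs
  · refine le_trans (le_of_eq ?_) (noedge p h0 h1 S T)
    refine Finset.sum_congr rfl fun g _ => ?_
    split_ifs <;> simp
  · simp

lemma markov {n : ℕ} (p : ℝ) (h0 : 0 ≤ p) (h1 : p ≤ 1) (A : GraphSeed n → Prop) (a b : ℝ)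
    (ha : 0 < a) (hA : ∀ g, ¬ A g → a ≤ MM g)
    (hM : ∑ g : GraphSeed n, graphWeight p g * MM g ≤ b * a) : 1 - b ≤ probG n p A := by
  have hg : ∀ g : GraphSeed n, graphWeight p g * a ≤
      (if A g then graphWeight p g else 0) * a + graphWeight p g * MM g := by
    intro g
    have hw := graphWeight_nonneg p h0 h1 g
    have hm := mul_nonneg hw (MM_nonneg g)
    by_cases h : A g
    · simp only [h, if_true]; linarith
    · simp only [h, if_false]
      have := mul_le_mul_of_nonneg_left (hA g h) hw
      linarith
  have := Finset.sum_le_sum fun (g : GraphSeed n) (_ : g ∈ univ) => hg g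
  rw [Finset.sum_add_distrib, ← Finset.sum_mul, ← Finset.sum_mul, graphWeight_sum] at this
  have h3 : (1 - b) * a ≤ probG n p A * a := by
    unfold probG
    linarith
  exact le_of_mul_le_mul_right h3 ha

lemma sum_pow_card (n : ℕ) (x : ℝ) : ∑ S : Finset (Fin n), x ^ S.card = (1 + x) ^ n := by
  have := Finset.prod_one_add (f := fun _ : Fin n => x) (univ : Finset (Fin n))
  simpa using this.symm

lemma half_exp (z : ℝ) : (1 + Real.exp (-z)) / 2 ≤ Real.exp (-z / 2 + z ^ 2 / 8) := by
  have h := Real.cosh_le_exp_half_sq (z / 2)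
  have e : (1 + Real.exp (-z)) / 2 = Real.exp (-z / 2) * Real.cosh (z / 2) := by
    rw [Real.cosh_eq, mul_div_assoc', mul_add, ← Real.exp_add, ← Real.exp_add]
    ring_nf
    simp [add_comm]
  rw [e, Real.exp_add]
  refine mul_le_mul_of_nonneg_left (h.trans (le_of_eq ?_)) (Real.exp_pos _).le
  ring_nf

lemma per_S (ε p L β y κ : ℝ) (n s : ℕ) (hε : 0 < ε) (hp0 : 0 ≤ p) (hp1 : p ≤ 1) (hL : 0 ≤ L)
    (hpn : n * p = (2 + ε) * L) (hβ : 0 < β) (hy0 : 0 < y) (hy1 : y ≤ 1)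
    (hκ : κ = (1 + Real.exp (-(2 * ε / (2 + ε)))) / 2) :
    (∑ T : Finset (Fin n), if s ≤ T.card then (1 - p) ^ (s * T.card) else 0)
      ≤ 2 ^ n * (Real.exp (-((1 + ε / 4) * L)) ^ s + (κ * y ^ (-β)) ^ n * y ^ s
        + Real.exp (-(p * (β * n) ^ 2))) := by
  have hr0 : 0 ≤ 1 - p := by linarith
  have hre : 1 - p ≤ Real.exp (-p) := by have := Real.add_one_le_exp (-p); linarith
  have hrk : ∀ k : ℕ, (1 - p) ^ k ≤ Real.exp (-(p * k)) := by
    intro k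
    calc (1 - p) ^ k ≤ (Real.exp (-p)) ^ k := pow_le_pow_left₀ hr0 hre k
      _ = _ := by rw [← Real.exp_nat_mul]; congr 1; ring
  have hκ0 : 0 < κ := by rw [hκ]; positivity
  have hyb : 0 < y ^ (-β) := Real.rpow_pos_of_pos hy0 _
  have P1 : 0 ≤ Real.exp (-((1 + ε / 4) * L)) ^ s := by positivity
  have P2 : 0 ≤ (κ * y ^ (-β)) ^ n * y ^ s := by positivity
  have P3 : 0 ≤ Real.exp (-(p * (β * n) ^ 2)) := by positivity
  by_cases hs : (s : ℝ) ≤ β * n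
  · have a1 : (∑ T : Finset (Fin n), if s ≤ T.card then (1 - p) ^ (s * T.card) else 0)
        ≤ (1 + (1 - p) ^ s) ^ n := by
      rw [← sum_pow_card]
      refine Finset.sum_le_sum fun T _ => ?_
      rw [← pow_mul]
      split_ifs
      · rfl
      · positivity
    have a2 : (1 + (1 - p) ^ s) ^ n ≤ 2 ^ n * ((1 + Real.exp (-(p * s))) / 2) ^ n := by
      rw [← mul_pow]
      have := hrk s
      refine pow_le_pow_left₀ (by positivity) (by linarith) n
    refine (a1.trans a2).trans (mul_le_mul_of_nonneg_left ?_ (by positivity))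
    by_cases hd : p * s ≤ 2 * ε / (2 + ε)
    · have a3 : ((1 + Real.exp (-(p * s))) / 2) ^ n ≤ Real.exp (-((1 + ε / 4) * L)) ^ s := by
        refine (pow_le_pow_left₀ (by positivity) (half_exp (p * s)) n).trans ?_
        rw [← Real.exp_nat_mul, ← Real.exp_nat_mul]
        apply Real.exp_le_exp.mpr
        have e1 : (n:ℝ) * (-(p * s) / 2 + (p * s) ^ 2 / 8)
            = ((2 + ε) * L) * s * (-1 / 2 + p * s / 8) := by rw [← hpn]; ring
        rw [e1]
        have e2 : (2 + ε) * (p * s) ≤ 2 * ε := by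
          rw [le_div_iff₀ (by linarith)] at hd; linarith
        have e3 : 0 ≤ L * s := by positivity
        nlinarith [mul_le_mul_of_nonneg_left e2 e3]
      linarith
    · push Not at hd
      have a3 : ((1 + Real.exp (-(p * s))) / 2) ^ n ≤ κ ^ n := by
        refine pow_le_pow_left₀ (by positivity) ?_ n
        rw [hκ]
        have := Real.exp_le_exp.mpr (neg_le_neg hd.le)
        linarith
      have a4 : 1 ≤ (y ^ (-β)) ^ n * y ^ s := by
        rw [← Real.rpow_natCast, ← Real.rpow_natCast, ← Real.rpow_mul hy0.le, ← Real.rpow_add hy0]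
        exact Real.one_le_rpow_of_pos_of_le_one_of_nonpos hy0 hy1 (by linarith)
      have a5 : κ ^ n ≤ (κ * y ^ (-β)) ^ n * y ^ s := by
        rw [mul_pow, mul_assoc]
        exact le_mul_of_one_le_right (by positivity) a4
      linarith
  · push Not at hs
    have b1 : ∀ T : Finset (Fin n), (if s ≤ T.card then (1 - p) ^ (s * T.card) else 0)
        ≤ Real.exp (-(p * (β * n) ^ 2)) := by
      intro T
      split_ifs with h
      · refine (hrk _).trans (Real.exp_le_exp.mpr (neg_le_neg ?_))
        refine mul_le_mul_of_nonneg_left ?_ hp0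
        push_cast
        have h' : (s:ℝ) ≤ T.card := by exact_mod_cast h
        have hb0 : 0 ≤ β * n := by positivity
        nlinarith
      · exact P3
    refine (Finset.sum_le_sum fun T _ => b1 T).trans ?_
    rw [Finset.sum_const, Finset.card_univ, nsmul_eq_mul]
    simp only [Fintype.card_finset, Fintype.card_fin]
    push_cast
    refine mul_le_mul_of_nonneg_left ?_ (by positivity)
    linarith

lemma total_bound (ε p L β y κ : ℝ) (n : ℕ) (hε : 0 < ε) (hp0 : 0 ≤ p) (hp1 : p ≤ 1) (hL : 0 ≤ L)
    (hpn : n * p = (2 + ε) * L) (hβ : 0 < β) (hy0 : 0 < y) (hy1 : y ≤ 1)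
    (hκ : κ = (1 + Real.exp (-(2 * ε / (2 + ε)))) / 2) :
    (∑ S : Finset (Fin n), ∑ T : Finset (Fin n),
        if S.Nonempty ∧ T.Nonempty then (1 - p) ^ (S.card * T.card) else 0)
      ≤ 2 * (2 ^ n * (((1 + Real.exp (-((1 + ε / 4) * L))) ^ n - 1)
        + (κ * y ^ (-β) * (1 + y)) ^ n + 2 ^ n * Real.exp (-(p * (β * n) ^ 2)))) := by
  have hr0 : 0 ≤ 1 - p := by linarith
  set G : Finset (Fin n) → Finset (Fin n) → ℝ := fun S T =>
    if S.Nonempty then (if S.card ≤ T.card then (1 - p) ^ (S.card * T.card) else 0) else 0 with hG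
  have hG0 : ∀ S T, 0 ≤ G S T := by
    intro S T; simp only [hG]; split_ifs <;> positivity
  have h1 : ∀ S T : Finset (Fin n),
      (if S.Nonempty ∧ T.Nonempty then (1 - p) ^ (S.card * T.card) else 0) ≤ G S T + G T S := by
    intro S T
    split_ifs with h
    · rcases le_total S.card T.card with h2 | h2
      · have : G S T = (1 - p) ^ (S.card * T.card) := by simp [hG, h.1, h2]
        have := hG0 T S
        linarith
      · have : G T S = (1 - p) ^ (S.card * T.card) := by simp [hG, h.2, h2, mul_comm]
        have := hG0 S T
        linarith
    · exact add_nonneg (hG0 _ _) (hG0 _ _)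
  refine (Finset.sum_le_sum fun S _ => Finset.sum_le_sum fun T _ => h1 S T).trans ?_
  simp_rw [Finset.sum_add_distrib]
  rw [Finset.sum_comm (f := fun S T => G T S), ← two_mul]
  refine mul_le_mul_of_nonneg_left ?_ (by norm_num)
  set x := Real.exp (-((1 + ε / 4) * L)) with hx
  have h2 : ∀ S : Finset (Fin n), ∑ T, G S T ≤ 2 ^ n * ((x ^ S.card - if S = ∅ then 1 else 0)
      + (κ * y ^ (-β)) ^ n * y ^ S.card + Real.exp (-(p * (β * n) ^ 2))) := by
    intro S
    rcases S.eq_empty_or_nonempty with h | h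
    · subst h
      have hκ0 : 0 < κ := by rw [hκ]; positivity
      have hyb : 0 < y ^ (-β) := Real.rpow_pos_of_pos hy0 _
      simp [hG]
      positivity
    · have := per_S ε p L β y κ n S.card hε hp0 hp1 hL hpn hβ hy0 hy1 hκ
      simp only [hG, h, if_true, h.ne_empty, if_false, sub_zero]
      exact this
  refine (Finset.sum_le_sum fun S _ => h2 S).trans (le_of_eq ?_)
  rw [← Finset.mul_sum, Finset.sum_add_distrib, Finset.sum_add_distrib, Finset.sum_sub_distrib,
    ← Finset.mul_sum, sum_pow_card, sum_pow_card, mul_pow _ (1 + y)]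
  simp

lemma exists_params (κ : ℝ) (h0 : 0 < κ) (h1 : κ < 1) :
    ∃ β y : ℝ, 0 < β ∧ 0 < y ∧ y ≤ 1 ∧ κ * y ^ (-β) * (1 + y) < 1 := by
  set y := (1 - κ) / 2 with hy
  have hy0 : 0 < y := by linarith
  have hc : ContinuousAt (fun β : ℝ => κ * y ^ (-β) * (1 + y)) 0 := by
    have : ContinuousAt (fun β : ℝ => y ^ (-β)) 0 :=
      (Real.continuous_const_rpow hy0.ne').continuousAt.comp continuous_neg.continuousAt
    exact (continuousAt_const.mul this).mul continuousAt_const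
  have hlt : κ * y ^ (-(0:ℝ)) * (1 + y) < 1 := by
    simp; nlinarith
  have hev := hc.eventually_lt continuousAt_const hlt
  have hev2 : ∀ᶠ β in nhdsWithin (0:ℝ) (Set.Ioi 0), κ * y ^ (-β) * (1 + y) < 1 :=
    nhdsWithin_le_nhds hev
  obtain ⟨β, hb, hb0⟩ := (hev2.and self_mem_nhdsWithin).exists
  exact ⟨β, y, hb0, hy0, by linarith, hb⟩

lemma analytic (ε : ℝ) (hε : 0 < ε) : ∃ N : ℕ, 1 ≤ N ∧ ∀ n : ℕ, N ≤ n →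
    0 ≤ (2 + ε) * Real.log n / n ∧ (2 + ε) * Real.log n / n ≤ 1 ∧
    (∑ S : Finset (Fin n), ∑ T : Finset (Fin n),
        if S.Nonempty ∧ T.Nonempty then (1 - (2 + ε) * Real.log n / n) ^ (S.card * T.card) else 0)
      ≤ 8 * (n : ℝ) ^ (-(ε / 4)) * 2 ^ n := by
  set κ := (1 + Real.exp (-(2 * ε / (2 + ε)))) / 2 with hκ
  have hκ0 : 0 < κ := by positivity
  have hκ1 : κ < 1 := by
    have : Real.exp (-(2 * ε / (2 + ε))) < 1 := by
      rw [Real.exp_lt_one_iff]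
      have : 0 < 2 * ε / (2 + ε) := by positivity
      linarith
    linarith
  obtain ⟨β, y, hβ, hy0, hy1, hρ⟩ := exists_params κ hκ0 hκ1
  set ρ := κ * y ^ (-β) * (1 + y) with hρd
  have hρ0 : 0 < ρ := by
    have : 0 < y ^ (-β) := Real.rpow_pos_of_pos hy0 _
    positivity
  -- log n / n → 0
  have hlim : Filter.Tendsto (fun n : ℕ => Real.log n / n) Filter.atTop (nhds 0) := by
    have := Real.isLittleO_log_id_atTop.tendsto_div_nhds_zero
    exact this.comp tendsto_natCast_atTop_atTop
  have hlog : Filter.Tendsto (fun n : ℕ => Real.log n) Filter.atTop Filter.atTop :=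
    Real.tendsto_log_atTop.comp tendsto_natCast_atTop_atTop
  set d := min (1 / (2 + ε)) (min (4 / ε * (-Real.log ρ)) (4 / ε)) with hd
  have hlρ : Real.log ρ < 0 := Real.log_neg hρ0 hρ
  have hd0 : 0 < d := by
    rw [hd, lt_min_iff, lt_min_iff]
    refine ⟨by positivity, ?_, by positivity⟩
    exact mul_pos (by positivity) (by linarith)
  have ev1 := hlim.eventually (gt_mem_nhds hd0)
  have ev2 := hlog.eventually_ge_atTop (2 / ((2 + ε) * β ^ 2))
  obtain ⟨N, hN⟩ := Filter.eventually_atTop.mp (ev1.and ev2)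
  refine ⟨max N 1, le_max_right _ _, fun n hn => ?_⟩
  obtain ⟨e1, e2⟩ := hN n (le_trans (le_max_left _ _) hn)
  have hn1 : 1 ≤ n := le_trans (le_max_right _ _) hn
  have hnp : (0:ℝ) < n := by exact_mod_cast hn1
  have hn1' : (1:ℝ) ≤ n := by exact_mod_cast hn1
  set L := Real.log n with hL
  have hL0 : 0 ≤ L := Real.log_nonneg hn1'
  have d1 : L / n < 1 / (2 + ε) := e1.trans_le (min_le_left _ _)
  have d2 : L / n < 4 / ε * (-Real.log ρ) :=
    e1.trans_le ((min_le_right _ _).trans (min_le_left _ _))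
  have d3 : L / n < 4 / ε := e1.trans_le ((min_le_right _ _).trans (min_le_right _ _))
  set p := (2 + ε) * L / n with hp
  have hp0 : 0 ≤ p := by positivity
  have hp1 : p ≤ 1 := by
    rw [lt_div_iff₀ (by linarith)] at d1
    have : p = L / n * (2 + ε) := by rw [hp]; ring
    linarith
  have hpn : n * p = (2 + ε) * L := by rw [hp]; field_simp
  refine ⟨hp0, hp1, ?_⟩
  have hpow : (n : ℝ) ^ (-(ε / 4)) = Real.exp (-(ε / 4 * L)) := by
    rw [Real.rpow_def_of_pos hnp]; congr 1; ring
  refine (total_bound ε p L β y κ n hε hp0 hp1 hL0 hpn hβ hy0 hy1 hκ).trans ?_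
  rw [hpow]
  set q := Real.exp (-(ε / 4 * L)) with hq
  have hq1 : q ≤ 1 := by rw [hq, Real.exp_le_one_iff]; have : 0 ≤ ε / 4 * L := by positivity
                         linarith
  have hq0 : 0 < q := Real.exp_pos _
  have t1 : (1 + Real.exp (-((1 + ε / 4) * L))) ^ n - 1 ≤ 2 * q := by
    set x := Real.exp (-((1 + ε / 4) * L)) with hx
    have hxq : n * x = q := by
      have : (n : ℝ) = Real.exp L := (Real.exp_log hnp).symm
      rw [this, hx, hq, ← Real.exp_add]
      congr 1; ring
    have : (1 + x) ^ n ≤ Real.exp q := by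
      rw [← hxq, Real.exp_nat_mul]
      refine pow_le_pow_left₀ (by positivity) ?_ n
      have := Real.add_one_le_exp x
      linarith
    have h2 := Real.abs_exp_sub_one_le (x := q) (by rw [abs_of_pos hq0]; exact hq1)
    rw [abs_of_pos hq0] at h2
    have := le_abs_self (Real.exp q - 1)
    linarith
  have t2 : ρ ^ n ≤ q := by
    rw [← Real.exp_log hρ0, ← Real.exp_nat_mul, hq]
    apply Real.exp_le_exp.mpr
    rw [div_lt_iff₀ hnp] at d2
    have : ε / 4 * L ≤ ε / 4 * (4 / ε * (-Real.log ρ) * n) :=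
      mul_le_mul_of_nonneg_left d2.le (by positivity)
    have e : ε / 4 * (4 / ε * (-Real.log ρ) * n) = - (n * Real.log ρ) := by field_simp
    linarith
  have t3 : 2 ^ n * Real.exp (-(p * (β * n) ^ 2)) ≤ q := by
    have h2 : (2:ℝ) ^ n ≤ Real.exp n := by
      rw [← mul_one (n:ℝ), Real.exp_nat_mul]
      refine pow_le_pow_left₀ (by norm_num) ?_ n
      have := Real.add_one_le_exp 1
      linarith
    have h3 : p * (β * n) ^ 2 = n * ((2 + ε) * β ^ 2 * L) := by
      calc p * (β * n) ^ 2 = (n * p) * (β ^ 2 * n) := by ring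
        _ = _ := by rw [hpn]; ring
    have h4 : 2 ≤ (2 + ε) * β ^ 2 * L := by
      rw [div_le_iff₀ (by positivity)] at e2
      linarith
    rw [div_lt_iff₀ hnp] at d3
    have h5 : ε / 4 * L ≤ n := by
      have : ε / 4 * L ≤ ε / 4 * (4 / ε * n) := mul_le_mul_of_nonneg_left d3.le (by positivity)
      have e : ε / 4 * (4 / ε * n) = n := by field_simp
      linarith
    calc 2 ^ n * Real.exp (-(p * (β * n) ^ 2)) ≤ Real.exp n * Real.exp (-(p * (β * n) ^ 2)) := by
          gcongr
      _ = Real.exp (n - p * (β * n) ^ 2) := by rw [← Real.exp_add]; rfl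
      _ ≤ q := by
        rw [hq]
        apply Real.exp_le_exp.mpr
        rw [h3]
        nlinarith
  have hp2 : (0:ℝ) < 2 ^ n := by positivity
  calc _ ≤ 2 * (2 ^ n * (2 * q + q + q)) := by gcongr
    _ = _ := by ring

/-- **High connectivity.** For `p = (2+ε) log n / n`, with probability at least
`1 - 2 n^{-ε/8}` over `G ~ G(n,p)`, the total variation distance between the law of
the number of PNE and Poisson(1) is at most `C n^{-ε/8} + C e^{-c n}`. -/
theorem stmt0 (ε : ℝ) (hε : 0 < ε) :
    ∃ C c : ℝ, 0 < C ∧ 0 < c ∧ ∃ N : ℕ, ∀ n : ℕ, N ≤ n →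
      1 - 2 * (n : ℝ) ^ (-(ε / 8)) ≤
        probG n ((2 + ε) * Real.log n / n)
          (fun g => tvDistPoisson n g ≤ C * (n : ℝ) ^ (-(ε / 8)) + C * Real.exp (-(c * n))) := by
  obtain ⟨N, hN1, hN⟩ := analytic ε hε
  refine ⟨192, 1 / 4, by norm_num, by norm_num, N, fun n hn => ?_⟩
  obtain ⟨hp0, hp1, hM⟩ := hN n hn
  have hn0 : 0 < n := by omega
  have hnp : (0:ℝ) < n := by exact_mod_cast hn0
  have hq0 : 0 < (n:ℝ) ^ (-(ε / 8)) := Real.rpow_pos_of_pos hnp _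
  have h2n : (0:ℝ) < 2 ^ n := by positivity
  have hexp : 12 * (n:ℝ) / 2 ^ n ≤ 192 * Real.exp (-(1 / 4 * n)) := by
    rw [div_le_iff₀ h2n]
    have a1 : (2:ℝ) ^ n = Real.exp (n * Real.log 2) := by
      rw [Real.exp_nat_mul, Real.exp_log (by norm_num)]
    rw [a1, mul_assoc, ← Real.exp_add]
    have a2 := Real.log_two_gt_d9
    have a3 : (n:ℝ) / 4 ≤ -(1 / 4 * n) + n * Real.log 2 := by nlinarith
    have a4 := Real.add_one_le_exp ((n:ℝ) / 4)
    have a5 := Real.exp_le_exp.mpr a3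
    linarith
  have key := markov (n := n) ((2 + ε) * Real.log n / n) hp0 hp1
    (fun g => tvDistPoisson n g ≤ 192 * (n : ℝ) ^ (-(ε / 8)) + 192 * Real.exp (-(1 / 4 * n)))
    (8 * (n:ℝ) ^ (-(ε / 8)) * 2 ^ n) ((n:ℝ) ^ (-(ε / 8))) (by positivity) (fun g hg => ?_) ?_
  · linarith
  · by_contra hlt
    push Not at hlt
    apply hg
    have := tv_bound hn0 g
    have h3 : MM g / 2 ^ n ≤ 8 * (n:ℝ) ^ (-(ε / 8)) := by
      rw [div_le_iff₀ h2n]; exact hlt.le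
    linarith
  · refine (MM_mean _ hp0 hp1).trans (hM.trans (le_of_eq ?_))
    have : (n:ℝ) ^ (-(ε / 4)) = (n:ℝ) ^ (-(ε / 8)) * (n:ℝ) ^ (-(ε / 8)) := by
      rw [← Real.rpow_add hnp]; congr 1; ring
    rw [this]; ring
end

section
/- There exist constants c₀ > 0 and N such that for every n ≥ N and every p ∈ [0, 1/n], the probability under the random G(n,p)-game measure that a pure Nash equilibrium exists is at most exp(−c₀·n²·p). -/
open scoped Classical
open Finset

/-- Joint probability of an event under the random `G(n,p)`-game measure `P_{(n,p)}`:
first draw `g ~ G(n,p)`, then independent uniform best-response tables `ω`. -/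
noncomputable def probGT (n : ℕ) (p : ℝ) (A : GraphSeed n → Tables n → Prop) : ℝ :=
  ∑ g : GraphSeed n, graphWeight p g * probT n (fun ω => A g ω)



/-- cons -/
def ocons {α : Type} (b : Bool) (g : α → Bool) : Option α → Bool := fun o => o.elim b g

lemma sum_option_fun {α : Type} [Fintype α] [DecidableEq α] [DecidableEq (Option α)]
    (F : (Option α → Bool) → ℝ) :
    ∑ g : Option α → Bool, F g = ∑ g : α → Bool, (F (ocons true g) + F (ocons false g)) := by
  have h : ∑ x : Bool × (α → Bool), F (ocons x.1 x.2) = ∑ g : Option α → Bool, F g := by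
    refine Fintype.sum_equiv
      { toFun := fun x => ocons x.1 x.2
        invFun := fun g => (g none, fun a => g (some a))
        left_inv := fun x => rfl
        right_inv := fun g => by funext o; cases o <;> rfl } _ _ (fun x => rfl)
  rw [← h, Fintype.sum_prod_type_right]
  simp

/-- weight -/
noncomputable def wt {ι : Type} [Fintype ι] (p : ℝ) (g : ι → Bool) : ℝ :=
  ∏ i, if g i then p else 1 - p

lemma wt_nonneg {ι : Type} [Fintype ι] {p : ℝ} (h0 : 0 ≤ p) (h1 : p ≤ 1) (g : ι → Bool) :
    0 ≤ wt p g := by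
  refine Finset.prod_nonneg fun i _ => ?_
  split_ifs <;> linarith

lemma wt_ocons {α : Type} [Fintype α] (p : ℝ) (b : Bool) (g : α → Bool) :
    wt p (ocons b g) = (if b then p else 1 - p) * wt p g := by
  simp only [wt, Fintype.prod_option, ocons]
  rfl

lemma one_step {p s L a b : ℝ} (h0 : 0 ≤ p) (hs : 0 ≤ s) (hL : s * L ≤ 1)
    (hab : |a - b| ≤ L) :
    p * Real.exp (-(s * a)) + (1 - p) * Real.exp (-(s * b)) ≤
      Real.exp (-(s * (p * a + (1 - p) * b)) + p * s ^ 2 * L ^ 2) := by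
  set x := -(s * (a - b)) with hx
  have hx1 : |x| ≤ s * L := by
    rw [hx, abs_neg, abs_mul, abs_of_nonneg hs]
    exact mul_le_mul_of_nonneg_left hab hs
  have hx2 : x ^ 2 ≤ s ^ 2 * L ^ 2 := by
    rw [← mul_pow, ← sq_abs x]
    exact pow_le_pow_left₀ (abs_nonneg _) hx1 2
  have h2 := (abs_le.1 (Real.abs_exp_sub_one_sub_id_le (hx1.trans hL))).2
  have h3 : Real.exp (-(s * a)) = Real.exp (-(s * b)) * Real.exp x := by
    rw [← Real.exp_add]; congr 1; rw [hx]; ring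
  have h4 : 1 + p * (Real.exp x - 1) ≤ Real.exp (p * x + p * s ^ 2 * L ^ 2) := by
    have := Real.add_one_le_exp (p * x + p * s ^ 2 * L ^ 2)
    have h5 : p * (Real.exp x - 1) ≤ p * (x + s ^ 2 * L ^ 2) :=
      mul_le_mul_of_nonneg_left (by linarith) h0
    linarith
  have h6 : Real.exp (-(s * (p * a + (1 - p) * b)) + p * s ^ 2 * L ^ 2)
      = Real.exp (-(s * b)) * Real.exp (p * x + p * s ^ 2 * L ^ 2) := by
    rw [← Real.exp_add]; congr 1; rw [hx]; ring
  rw [h6, h3]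
  calc _ = Real.exp (-(s * b)) * (1 + p * (Real.exp x - 1)) := by ring
    _ ≤ _ := mul_le_mul_of_nonneg_left h4 (Real.exp_pos _).le

lemma conc {p s L : ℝ} (h0 : 0 ≤ p) (h1 : p ≤ 1) (hs : 0 ≤ s) (hL : s * L ≤ 1)
    (ι : Type) [Fintype ι] : ∀ [DecidableEq ι] (f : (ι → Bool) → ℝ),
    (∀ g g' : ι → Bool, ∀ i, (∀ j, j ≠ i → g j = g' j) → |f g - f g'| ≤ L) →
    ∑ g, wt p g * Real.exp (-(s * f g)) ≤
      Real.exp (-(s * ∑ g, wt p g * f g) + (Fintype.card ι : ℝ) * (p * s ^ 2 * L ^ 2)) := by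
  refine Fintype.induction_empty_option (P := fun ι _ => ∀ [DecidableEq ι] (f : (ι → Bool) → ℝ),
    (∀ g g' : ι → Bool, ∀ i, (∀ j, j ≠ i → g j = g' j) → |f g - f g'| ≤ L) →
    ∑ g, wt p g * Real.exp (-(s * f g)) ≤
      Real.exp (-(s * ∑ g, wt p g * f g) + (Fintype.card ι : ℝ) * (p * s ^ 2 * L ^ 2)))
      ?_ ?_ ?_ ι
  · intro α β _ e ih _ f hf
    let _ : Fintype α := Fintype.ofEquiv β e.symm
    classical
    have := ih (fun g => f (fun b => g (e.symm b))) (by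
      intro g g' i h
      refine hf _ _ (e i) fun j hj => h _ ?_
      rintro rfl
      simp at hj)
    have hw : ∀ g : β → Bool, wt p (fun a => g (e a)) = wt p g := by
      intro g
      exact Fintype.prod_equiv e _ _ (fun a => rfl)
    have key : ∀ F : (β → Bool) → ℝ, ∑ g : α → Bool, F (fun b => g (e.symm b)) = ∑ g, F g := by
      intro F
      exact Fintype.sum_equiv (Equiv.arrowCongr e (Equiv.refl Bool)) _ _ (fun a => rfl)
    have hw' : ∀ g : α → Bool, wt p g = wt p (fun b => g (e.symm b)) := by
      intro g
      rw [← hw]; simp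
    simp only [hw'] at this
    rw [key (fun g => wt p g * Real.exp (-(s * f g))), key (fun g => wt p g * f g),
      Fintype.card_congr e] at this
    exact this
  · intro _ f hf
    simp [wt]
  · intro α _ ih _ f hf
    classical
    rw [sum_option_fun, sum_option_fun]
    simp only [wt_ocons, if_true, Bool.false_eq_true, if_false]
    have step : ∀ g : α → Bool, 
        p * wt p g * Real.exp (-(s * f (ocons true g))) +
          (1 - p) * wt p g * Real.exp (-(s * f (ocons false g))) ≤
        wt p g * Real.exp (-(s * (p * f (ocons true g) + (1 - p) * f (ocons false g))))
          * Real.exp (p * s ^ 2 * L ^ 2) := by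
      intro g
      have := one_step (a := f (ocons true g)) (b := f (ocons false g)) h0 hs hL
        (hf _ _ none (by intro j hj; cases j; exact absurd rfl hj; rfl))
      rw [Real.exp_add] at this
      have := mul_le_mul_of_nonneg_left this (wt_nonneg h0 h1 g)
      linarith
    refine (Finset.sum_le_sum fun g _ => step g).trans ?_
    rw [← Finset.sum_mul]
    have := ih (fun g => p * f (ocons true g) + (1 - p) * f (ocons false g)) (by
      intro g g' i h
      have hc : ∀ b, |f (ocons b g) - f (ocons b g')| ≤ L := by
        intro b
        refine hf _ _ (some i) ?_
        intro j hj
        cases j with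
        | none => rfl
        | some j => exact h j (by rintro rfl; exact hj rfl)
      have ht := abs_le.1 (hc true)
      have hf := abs_le.1 (hc false)
      rw [abs_le]
      constructor <;> nlinarith)
    refine (mul_le_mul_of_nonneg_right this (Real.exp_pos _).le).trans ?_
    rw [← Real.exp_add]
    apply le_of_eq
    congr 1
    rw [Fintype.card_option]
    push_cast
    have : ∀ g : α → Bool, wt p g * (p * f (ocons true g) + (1 - p) * f (ocons false g)) =
      p * wt p g * f (ocons true g) + (1 - p) * wt p g * f (ocons false g) := by intro g; ring
    simp only [this]
    ring

lemma wt_prod {ι : Type} [Fintype ι] [DecidableEq ι] (p : ℝ) (T : Finset ι) (i : ι) (hi : i ∉ T) :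
    ∑ g : ι → Bool, wt p g * (if g i = true ∧ ∀ j ∈ T, g j = false then 1 else 0)
      = p * (1 - p) ^ T.card := by
  have h : ∀ g : ι → Bool, wt p g * (if g i = true ∧ ∀ j ∈ T, g j = false then 1 else 0)
      = ∏ j, (if g j then (if j ∈ T then 0 else p) else (if j = i then 0 else 1 - p)) := by
    intro g
    split_ifs with hg
    · rw [mul_one]
      refine Finset.prod_congr rfl fun j _ => ?_
      by_cases hj : g j = true
      · have : j ∉ T := fun h => by simp [hg.2 j h] at hj
        simp [hj, this]
      · have : j ≠ i := by rintro rfl; exact hj hg.1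
        simp [hj, this]
    · rw [mul_zero, eq_comm]
      by_cases hgi : g i = true
      · have : ∃ j ∈ T, g j ≠ false := by
          by_contra hcon; push Not at hcon; exact hg ⟨hgi, hcon⟩
        obtain ⟨j, hj, hj'⟩ := this
        refine Finset.prod_eq_zero (Finset.mem_univ j) ?_
        simp at hj'
        simp [hj', hj]
      · refine Finset.prod_eq_zero (Finset.mem_univ i) ?_
        simp [hgi]
  simp only [h]
  have h2 := (Finset.prod_univ_sum (fun _ : ι => (Finset.univ : Finset Bool))
    (fun j b => if b then (if j ∈ T then (0:ℝ) else p) else (if j = i then 0 else 1 - p)))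
  rw [Fintype.piFinset_univ] at h2
  rw [← h2]
  simp only [Fintype.sum_bool, if_true, Bool.false_eq_true, if_false]
  have h3 : ∀ j, ((if j ∈ T then (0:ℝ) else p) + (if j = i then 0 else 1 - p)) =
    (if j = i then p else 1) * (if j ∈ T then (1 - p) else 1) := by
    intro j
    by_cases hj : j = i
    · subst hj; simp [hi]
    · by_cases hT : j ∈ T <;> simp [hj, hT]
  simp only [h3, Finset.prod_mul_distrib]
  simp

/-- incidence -/
def inc {n : ℕ} (u : Fin n) (e : EdgePair n) : Prop := e.1.1 = u ∨ e.1.2 = u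

/-- touching -/
def touch {n : ℕ} (e e' : EdgePair n) : Prop := inc e.1.1 e' ∨ inc e.1.2 e'

/-- isolated edge -/
def isoE {n : ℕ} (g : GraphSeed n) (e : EdgePair n) : Prop :=
  g e = true ∧ ∀ e', e' ≠ e → touch e e' → g e' = false

/-- the isolated edges -/
noncomputable def isoSet {n : ℕ} (g : GraphSeed n) : Finset (EdgePair n) :=
  Finset.univ.filter (isoE g)

lemma touch_symm {n : ℕ} {e e' : EdgePair n} (h : touch e e') : touch e' e := by
  unfold touch inc at *
  grind

lemma touch_self {n : ℕ} (e : EdgePair n) : touch e e := Or.inl (Or.inl rfl)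

lemma iso_unique {n : ℕ} {g : GraphSeed n} {e e' : EdgePair n} (h : isoE g e) (h' : isoE g e')
    (ht : touch e e') : e' = e := by
  by_contra hne
  have := h.2 e' hne ht
  rw [h'.1] at this
  exact absurd this (by simp)

lemma card_inc_iso {n : ℕ} (g : GraphSeed n) (u : Fin n) :
    ((isoSet g).filter (inc u)).card ≤ 1 := by
  rw [Finset.card_le_one]
  intro a ha b hb
  simp only [isoSet, Finset.mem_filter, Finset.mem_univ, true_and] at ha hb
  refine iso_unique hb.1 ha.1 ?_
  have h1 := ha.2
  have h2 := hb.2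
  unfold touch inc at *
  grind

lemma iso_lip_aux {n : ℕ} (g g' : GraphSeed n) (e : EdgePair n)
    (h : ∀ j, j ≠ e → g j = g' j) : (isoSet g).card ≤ (isoSet g').card + 2 := by
  have hsub : isoSet g ⊆ isoSet g' ∪
      ((isoSet g).filter (inc e.1.1) ∪ (isoSet g).filter (inc e.1.2)) := by
    intro a ha
    by_cases ht : touch e a
    · rcases ht with ht | ht
      · simp [ha, ht]
      · simp [ha, ht]
    · refine Finset.mem_union_left _ ?_
      simp only [isoSet, Finset.mem_filter, Finset.mem_univ, true_and] at ha ⊢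
      have hae : a ≠ e := by rintro rfl; exact ht (touch_self _)
      refine ⟨by rw [← h a hae]; exact ha.1, fun e' he' hte => ?_⟩
      have : e' ≠ e := by rintro rfl; exact ht (touch_symm hte)
      rw [← h e' this]
      exact ha.2 e' he' hte
  have h1 := Finset.card_le_card hsub
  have h2 := Finset.card_union_le (isoSet g')
    ((isoSet g).filter (inc e.1.1) ∪ (isoSet g).filter (inc e.1.2))
  have h3 := Finset.card_union_le ((isoSet g).filter (inc e.1.1)) ((isoSet g).filter (inc e.1.2))
  have h4 := card_inc_iso g e.1.1
  have h5 := card_inc_iso g e.1.2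
  omega

lemma iso_lip {n : ℕ} (g g' : GraphSeed n) (e : EdgePair n)
    (h : ∀ j, j ≠ e → g j = g' j) :
    |((isoSet g).card : ℝ) - ((isoSet g').card : ℝ)| ≤ 2 := by
  have h1 := iso_lip_aux g g' e h
  have h2 := iso_lip_aux g' g e (fun j hj => (h j hj).symm)
  have h1' : ((isoSet g).card : ℝ) ≤ (isoSet g').card + 2 := by exact_mod_cast h1
  have h2' : ((isoSet g').card : ℝ) ≤ (isoSet g).card + 2 := by exact_mod_cast h2
  rw [abs_le]
  constructor <;> linarith

lemma card_inc {n : ℕ} (u : Fin n) :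
    ((Finset.univ : Finset (EdgePair n)).filter (inc u)).card ≤ 2 * n := by
  have hsub : (Finset.univ : Finset (EdgePair n)).filter (inc u) ⊆
      (Finset.univ.filter fun e : EdgePair n => e.1.1 = u) ∪
      (Finset.univ.filter fun e : EdgePair n => e.1.2 = u) := by
    intro a ha
    simpa [inc] using ha
  have h1 : (Finset.univ.filter fun e : EdgePair n => e.1.1 = u).card ≤ n := by
    have := Finset.card_le_card_of_injOn (s := Finset.univ.filter fun e : EdgePair n => e.1.1 = u)
      (t := (Finset.univ : Finset (Fin n))) (fun e => e.1.2) (by simp)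
      (by
        intro a ha b hb hab
        simp at ha hb hab
        exact Subtype.ext (Prod.ext (ha.trans hb.symm) hab))
    simpa using this
  have h2 : (Finset.univ.filter fun e : EdgePair n => e.1.2 = u).card ≤ n := by
    have := Finset.card_le_card_of_injOn (s := Finset.univ.filter fun e : EdgePair n => e.1.2 = u)
      (t := (Finset.univ : Finset (Fin n))) (fun e => e.1.1) (by simp)
      (by
        intro a ha b hb hab
        simp at ha hb hab
        exact Subtype.ext (Prod.ext hab (ha.trans hb.symm)))
    simpa using this
  have h3 := Finset.card_le_card hsub
  have h4 := Finset.card_union_le (Finset.univ.filter fun e : EdgePair n => e.1.1 = u)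
    (Finset.univ.filter fun e : EdgePair n => e.1.2 = u)
  omega

/-- other touching edges -/
noncomputable def tset {n : ℕ} (e : EdgePair n) : Finset (EdgePair n) :=
  Finset.univ.filter fun e' => e' ≠ e ∧ touch e e'

lemma card_tset {n : ℕ} (e : EdgePair n) : (tset e).card ≤ 4 * n := by
  have hsub : tset e ⊆ Finset.univ.filter (inc e.1.1) ∪ Finset.univ.filter (inc e.1.2) := by
    intro a ha
    simp only [tset, Finset.mem_filter, Finset.mem_univ, true_and, Finset.mem_union] at ha ⊢
    exact ha.2
  have h3 := Finset.card_le_card hsub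
  have h4 := Finset.card_union_le (Finset.univ.filter (inc e.1.1)) (Finset.univ.filter (inc e.1.2))
  have h1 := card_inc e.1.1
  have h2 := card_inc e.1.2
  omega

lemma card_edge (n : ℕ) : n * n ≤ 2 * Fintype.card (EdgePair n) + n := by
  have := Fintype.card_le_of_surjective
    (fun x : (EdgePair n ⊕ EdgePair n) ⊕ Fin n => match x with
      | .inl (.inl e) => e.1
      | .inl (.inr e) => (e.1.2, e.1.1)
      | .inr i => (i, i)) (by
      rintro ⟨a, b⟩
      rcases lt_trichotomy a b with h | h | h
      · exact ⟨.inl (.inl ⟨(a, b), h⟩), rfl⟩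
      · exact ⟨.inr a, by simp [h]⟩
      · exact ⟨.inl (.inr ⟨(b, a), h⟩), rfl⟩)
  simp only [Fintype.card_sum, Fintype.card_prod, Fintype.card_fin] at this
  omega

lemma exp_iso {n : ℕ} (p : ℝ) (h0 : 0 ≤ p) (h1 : p ≤ 1) :
    (Fintype.card (EdgePair n) : ℝ) * (p * (1 - p) ^ (4 * n)) ≤
      ∑ g : GraphSeed n, wt p g * ((isoSet g).card : ℝ) := by
  have h : ∀ g : GraphSeed n, wt p g * ((isoSet g).card : ℝ) = ∑ e : EdgePair n,
      wt p g * (if g e = true ∧ ∀ j ∈ tset e, g j = false then 1 else 0) := by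
    intro g
    rw [← Finset.mul_sum, isoSet, Finset.card_filter]
    push_cast
    congr 1
    refine Finset.sum_congr rfl fun e _ => ?_
    refine if_congr ?_ rfl rfl
    simp [isoE, tset]
  simp only [h]
  rw [Finset.sum_comm]
  rw [← nsmul_eq_mul, ← Finset.card_univ, ← Finset.sum_const]
  refine Finset.sum_le_sum fun e _ => ?_
  have := wt_prod p (tset e) e (by simp [tset])
  refine le_of_le_of_eq ?_ this.symm
  exact mul_le_mul_of_nonneg_left
    (pow_le_pow_of_le_one (by linarith) (by linarith) (card_tset e)) h0

/-- point profile -/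
def ptab {n : ℕ} (v : Fin n) (b : Bool) : Fin n → Bool := fun x => if x = v then b else false

/-- local solvability -/
def good {n : ℕ} (e : EdgePair n) (ω : Tables n) : Prop :=
  ∃ a b, a = ω e.1.1 (ptab e.1.2 b) ∧ b = ω e.1.2 (ptab e.1.1 a)

lemma adj_fst {n : ℕ} {g : GraphSeed n} {e : EdgePair n} (h : isoE g e) (x : Fin n) :
    adjB g e.1.1 x = true ↔ x = e.1.2 := by
  obtain ⟨⟨u, v⟩, huv⟩ := e
  simp only at huv ⊢
  constructor
  · intro ha
    by_contra hx
    unfold adjB at ha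
    split_ifs at ha with h1 h2
    · rw [h.2 ⟨(u, x), h1⟩ (by intro hh; simp at hh; exact hx hh) (Or.inl (Or.inl rfl))] at ha
      simp at ha
    · rw [h.2 ⟨(x, u), h2⟩ (by
        intro hh; simp at hh; obtain ⟨rfl, rfl⟩ := hh; exact lt_irrefl _ h2) (Or.inl (Or.inr rfl))] at ha
      simp at ha
  · rintro rfl
    unfold adjB
    rw [dif_pos huv]
    exact h.1

lemma adj_snd {n : ℕ} {g : GraphSeed n} {e : EdgePair n} (h : isoE g e) (x : Fin n) :
    adjB g e.1.2 x = true ↔ x = e.1.1 := by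
  obtain ⟨⟨u, v⟩, huv⟩ := e
  simp only at huv ⊢
  constructor
  · intro ha
    by_contra hx
    unfold adjB at ha
    split_ifs at ha with h1 h2
    · rw [h.2 ⟨(v, x), h1⟩ (by
        intro hh; simp at hh; obtain ⟨rfl, rfl⟩ := hh; exact lt_irrefl _ h1) (Or.inr (Or.inl rfl))] at ha
      simp at ha
    · rw [h.2 ⟨(x, v), h2⟩ (by intro hh; simp at hh; exact hx hh) (Or.inr (Or.inr rfl))] at ha
      simp at ha
  · rintro rfl
    unfold adjB
    rw [dif_neg (not_lt.2 huv.le), dif_pos huv]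
    exact h.1

lemma pne_good {n : ℕ} {g : GraphSeed n} {e : EdgePair n} {ω : Tables n} (h : isoE g e)
    {σ : Fin n → Bool} (hσ : isPNE g ω σ) : good e ω := by
  refine ⟨σ e.1.1, σ e.1.2, ?_, ?_⟩
  · have : maskG g e.1.1 σ = ptab e.1.2 (σ e.1.2) := by
      funext x
      unfold maskG ptab
      by_cases hx : x = e.1.2
      · rw [if_pos ((adj_fst h x).2 hx), if_pos hx, hx]
      · rw [if_neg (fun hh => hx ((adj_fst h x).1 hh)), if_neg hx]
    rw [← this]; exact hσ _
  · have : maskG g e.1.2 σ = ptab e.1.1 (σ e.1.1) := by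
      funext x
      unfold maskG ptab
      by_cases hx : x = e.1.1
      · rw [if_pos ((adj_snd h x).2 hx), if_pos hx, hx]
      · rw [if_neg (fun hh => hx ((adj_snd h x).1 hh)), if_neg hx]
    rw [← this]; exact hσ _

/-- xor shift -/
def shift {n : ℕ} (e : EdgePair n) (s : Bool × Bool → Bool) (ω : Tables n) : Tables n :=
  fun w τ => xor (ω w τ) (if w = e.1.1 then s (false, τ e.1.2) else
    if w = e.1.2 then s (true, τ e.1.1) else false)

lemma shift_invol {n : ℕ} (e : EdgePair n) (s : Bool × Bool → Bool) :
    Function.Involutive (shift e s) := by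
  intro ω
  funext w τ
  simp [shift]

lemma exists_bad {n : ℕ} (e : EdgePair n) (ω : Tables n) : ∃ s, ¬ good e (shift e s ω) := by
  refine ⟨fun x => if x.1 then xor (ω e.1.2 (ptab e.1.1 x.2)) (!x.2)
    else xor (ω e.1.1 (ptab e.1.2 x.2)) x.2, ?_⟩
  rintro ⟨a, b, h1, h2⟩
  have hne : e.1.2 ≠ e.1.1 := ne_of_gt e.2
  simp only [shift, ptab, if_true, if_neg hne, Bool.false_eq_true, if_false] at h1 h2
  revert h1 h2
  generalize ω e.1.1 (ptab e.1.2 b) = c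
  generalize ω e.1.2 (ptab e.1.1 a) = d
  clear hne
  revert a b c d
  decide

lemma good_shift {n : ℕ} {e e' : EdgePair n} (h : ¬ touch e e') (s) (ω : Tables n) :
    good e' (shift e s ω) ↔ good e' ω := by
  have h1 : e'.1.1 ≠ e.1.1 := fun hh => h (Or.inl (Or.inl hh))
  have h2 : e'.1.2 ≠ e.1.1 := fun hh => h (Or.inl (Or.inr hh))
  have h3 : e'.1.1 ≠ e.1.2 := fun hh => h (Or.inr (Or.inl hh))
  have h4 : e'.1.2 ≠ e.1.2 := fun hh => h (Or.inr (Or.inr hh))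
  simp [good, shift, h1, h2, h3, h4]

lemma tables_count {n : ℕ} (M : Finset (EdgePair n)) :
    (∀ e ∈ M, ∀ e' ∈ M, touch e e' → e' = e) →
    (∑ ω : Tables n, if ∀ e ∈ M, good e ω then (1:ℝ) else 0) ≤
      (15 / 16) ^ M.card * (Fintype.card (Tables n) : ℝ) := by
  induction M using Finset.induction_on with
  | empty => intro _; simp
  | insert e M he ih =>
    intro h
    have ih := ih (fun a ha b hb => h a (Finset.mem_insert_of_mem ha) b (Finset.mem_insert_of_mem hb))
    rw [Finset.card_insert_of_notMem he]
    set R : Tables n → ℝ := fun ω => if ∀ e ∈ M, good e ω then 1 else 0 with hR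
    set B : Tables n → ℝ := fun ω => if good e ω then 0 else 1 with hB
    have hR0 : ∀ ω, 0 ≤ R ω := by intro ω; simp only [hR]; split_ifs <;> norm_num
    have hB0 : ∀ ω, 0 ≤ B ω := by intro ω; simp only [hB]; split_ifs <;> norm_num
    have hRs : ∀ s ω, R (shift e s ω) = R ω := by
      intro s ω
      simp only [hR]
      refine if_congr ?_ rfl rfl
      refine forall₂_congr fun e' he' => ?_
      refine good_shift (fun ht => ?_) s ω
      have := h e (Finset.mem_insert_self _ _) e' (Finset.mem_insert_of_mem he') ht
      exact he (this ▸ he')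
    have hsum : ∀ s, ∑ ω, B (shift e s ω) * R (shift e s ω) = ∑ ω, B ω * R ω := by
      intro s
      exact Fintype.sum_equiv (shift_invol e s).toPerm _ _ (fun ω => rfl)
    have h16 : ∑ ω, R ω ≤ 16 * ∑ ω, B ω * R ω := by
      calc ∑ ω, R ω ≤ ∑ ω, ∑ s : Bool × Bool → Bool, B (shift e s ω) * R (shift e s ω) := by
            refine Finset.sum_le_sum fun ω _ => ?_
            obtain ⟨s, hs⟩ := exists_bad e ω
            have h1 : B (shift e s ω) * R (shift e s ω) = R ω := by
              rw [hRs]; simp [hB, hs]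
            rw [← h1]
            exact Finset.single_le_sum
              (f := fun s => B (shift e s ω) * R (shift e s ω))
              (fun i _ => mul_nonneg (hB0 _) (hR0 _)) (Finset.mem_univ s)
        _ = 16 * ∑ ω, B ω * R ω := by
            rw [Finset.sum_comm]
            simp only [hsum]
            simp
    have heq : (∑ ω : Tables n, if ∀ e' ∈ insert e M, good e' ω then (1:ℝ) else 0)
        = ∑ ω, R ω - ∑ ω, B ω * R ω := by
      rw [← Finset.sum_sub_distrib]
      refine Finset.sum_congr rfl fun ω _ => ?_
      simp only [hR, hB, Finset.forall_mem_insert]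
      by_cases h1 : good e ω <;> by_cases h2 : ∀ e ∈ M, good e ω <;> simp [h1, h2]
    rw [heq, pow_succ]
    linarith

lemma probT_le {n : ℕ} (g : GraphSeed n) {s : ℝ} (hs : s ≤ 1 / 16) :
    probT n (fun ω => ∃ σ, isPNE g ω σ) ≤ Real.exp (-(s * ((isoSet g).card : ℝ))) := by
  have hc : (0:ℝ) < (Fintype.card (Tables n) : ℝ) := by exact_mod_cast Fintype.card_pos
  unfold probT
  rw [div_le_iff₀ hc]
  have h1 : (∑ ω : Tables n, if ∃ σ, isPNE g ω σ then (1:ℝ) else 0) ≤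
      ∑ ω : Tables n, if ∀ e ∈ isoSet g, good e ω then (1:ℝ) else 0 := by
    refine Finset.sum_le_sum fun ω _ => ?_
    by_cases h : ∃ σ, isPNE g ω σ
    · have : ∀ e ∈ isoSet g, good e ω := by
        intro e he
        obtain ⟨σ, hσ⟩ := h
        exact pne_good (by simpa [isoSet] using he) hσ
      rw [if_pos h, if_pos this]
    · rw [if_neg h]; split_ifs <;> norm_num
  refine le_trans (le_of_eq (Finset.sum_congr rfl fun ω _ => by congr))
    (h1.trans ((tables_count (isoSet g) ?_).trans ?_))
  · intro e he e' he' ht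
    exact iso_unique (by simpa [isoSet] using he) (by simpa [isoSet] using he') ht
  · refine mul_le_mul_of_nonneg_right ?_ hc.le
    have : (15/16 : ℝ) ≤ Real.exp (-s) := by
      have := Real.add_one_le_exp (-s)
      linarith
    calc _ ≤ (Real.exp (-s)) ^ (isoSet g).card := pow_le_pow_left₀ (by norm_num) this _
      _ = _ := by rw [← Real.exp_nat_mul]; congr 1; ring

lemma one_sub_ge {p : ℝ} (h0 : 0 ≤ p) (h1 : p ≤ 1 / 2) : Real.exp (-(2 * p)) ≤ 1 - p := by
  have h := Real.add_one_le_exp (2 * p)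
  rw [Real.exp_neg]
  refine inv_le_of_inv_le₀ (by linarith) ?_
  refine le_trans ?_ h
  rw [inv_le_iff_one_le_mul₀ (by linarith)]
  nlinarith

/-- **Medium connectivity, very sparse regime.** There are constants `c₀ > 0` and `N` such
that for all `n ≥ N` and all `p ∈ [0, 1/n]`, the probability that a random `G(n,p)`-game
has a pure Nash equilibrium is at most `exp(-c₀ n² p)`. -/
theorem stmt2 :
    ∃ c₀ : ℝ, 0 < c₀ ∧ ∃ N : ℕ, ∀ n : ℕ, N ≤ n → ∀ p : ℝ, 0 ≤ p → p ≤ 1 / (n : ℝ) →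
      probGT n p (fun g ω => ∃ σ, isPNE g ω σ) ≤ Real.exp (-(c₀ * (n : ℝ) ^ 2 * p)) := by
  obtain ⟨κ, hκ⟩ : ∃ κ, κ = Real.exp (-8) := ⟨_, rfl⟩
  have hκ0 : 0 < κ := hκ ▸ Real.exp_pos _
  have hκ1 : κ ≤ 1 := by rw [hκ]; exact Real.exp_le_one_iff.2 (by norm_num)
  refine ⟨κ ^ 2 / 128, by positivity, 2, fun n hn p h0 hp => ?_⟩
  have hn' : (2:ℝ) ≤ n := by exact_mod_cast hn
  have hnp : n * p ≤ 1 := by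
    have := mul_le_mul_of_nonneg_left hp (by linarith : (0:ℝ) ≤ n)
    rwa [mul_one_div_cancel (by linarith)] at this
  have hp2 : p ≤ 1 / 2 := hp.trans (one_div_le_one_div_of_le (by norm_num) hn')
  have hs0 : 0 ≤ κ / 16 := by positivity
  have hcon := conc (p := p) (s := κ / 16) (L := 2) h0 (by linarith) hs0 (by linarith)
    (EdgePair n) (fun g => ((isoSet g).card : ℝ)) (fun g g' e h => iso_lip g g' e h)
  have hE := exp_iso (n := n) p h0 (by linarith)
  have hpow : κ ≤ (1 - p) ^ (4 * n) := by
    calc κ ≤ (Real.exp (-(2 * p))) ^ (4 * n) := by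
          rw [hκ, ← Real.exp_nat_mul]
          apply Real.exp_le_exp.2
          push_cast
          nlinarith
      _ ≤ _ := pow_le_pow_left₀ (Real.exp_pos _).le (one_sub_ge h0 hp2) _
  have hN : (n:ℝ) ^ 2 / 4 ≤ (Fintype.card (EdgePair n) : ℝ) := by
    have : (n:ℝ) * n ≤ 2 * (Fintype.card (EdgePair n) : ℝ) + n := by exact_mod_cast card_edge n
    nlinarith
  calc probGT n p (fun g ω => ∃ σ, isPNE g ω σ)
      ≤ ∑ g : GraphSeed n, wt p g * Real.exp (-(κ / 16 * ((isoSet g).card : ℝ))) := by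
        unfold probGT
        refine Finset.sum_le_sum fun g _ => ?_
        exact mul_le_mul_of_nonneg_left (probT_le g (by linarith)) (wt_nonneg h0 (by linarith) g)
    _ ≤ _ := by
        refine le_of_eq_of_le ?_ (hcon.trans ?_)
        · rfl
        · apply Real.exp_le_exp.2
          generalize (Fintype.card (EdgePair n) : ℝ) = m at *
          have hm : 0 ≤ m := le_trans (by positivity) hN
          have h1 : m * (p * κ) ≤ m * (p * (1 - p) ^ (4 * n)) := by gcongr
          have h2 := mul_le_mul_of_nonneg_left (h1.trans hE) hs0
          have h3 : (n:ℝ) ^ 2 / 4 * (p * κ ^ 2) ≤ m * (p * κ ^ 2) := by gcongr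
          have h4 : 0 ≤ m * (p * κ ^ 2) := by positivity
          nlinarith
end
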